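/- arXiv:1712.04208 — 4 statements merged into one kernel-verified Lean document; each statement's English description precedes it below -/
import Mathlib

section
/- Let a ≥ 0, b ≥ 1 and let E ⊆ ⋃_{n≥1} B_n^{a,b} be a stable set. The following are equivalent: (i) for every 1 < q < ∞, lim_n n^{−1/q}·γ_{q,n}(E) = 0; (ii) for some 1 < q < ∞, lim_n n^{−1/q}·γ_{q,n}(E) = 0; (iii) lim_n Υ_n(E) = 0; (iv) for every ϱ > 0 there exists N ∈ ℕ such that for all n ≥ N, E ∩ B_n^{a,b} contains no ϱ-c₀-sequence; (v) there does not exist c > 0 such that for every n ∈ ℕ the pair (r,ρ) with r(∑ a_i e_i) = max_{1≤i≤n} |a_i| and ρ(∑ a_i e_i) = c·max_{1≤i≤n} |a_i| belongs to E ∩ B_n^{a,b} (i.e. c·Id_{c₀} is not block finitely representable on E). -/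
open scoped BigOperators ENNReal

noncomputable section

namespace AsymSeminorms

variable {𝕜 : Type*} [RCLike 𝕜]

/-- A pair of seminorms on `𝕜^n`, used to encode a (finite) basic sequence together with
the seminorm induced by an operator. -/
abbrev SNPair (𝕜 : Type*) [RCLike 𝕜] (n : ℕ) : Type _ :=
  Seminorm 𝕜 (Fin n → 𝕜) × Seminorm 𝕜 (Fin n → 𝕜)

/-- Truncation of a vector in `𝕜^n` to its first `m` coordinates (the rest set to `0`);
this encodes `∑_{i=1}^m a_i e_i`. -/
def trunc {n : ℕ} (m : ℕ) (a : Fin n → 𝕜) : Fin n → 𝕜 :=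
  fun i => if (i : ℕ) < m then a i else 0

/-- Membership in the set `B_n^{a,b}` (here the constants are called `ca`, `cb`):
`r = P.1` is a norm with `r(e_i) = 1`, both seminorms satisfy the `b`-basis inequality for
truncations, and `ρ = P.2` satisfies `ρ ≤ a·r`. -/
structure MemB (ca cb : ℝ) {n : ℕ} (P : SNPair 𝕜 n) : Prop where
  eq_zero_of : ∀ x : Fin n → 𝕜, P.1 x = 0 → x = 0
  single_eq_one : ∀ i : Fin n, P.1 (Pi.single i 1) = 1
  trunc_fst : ∀ m : ℕ, m ≤ n → ∀ a : Fin n → 𝕜, P.1 (trunc m a) ≤ cb * P.1 a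
  trunc_snd : ∀ m : ℕ, m ≤ n → ∀ a : Fin n → 𝕜, P.2 (trunc m a) ≤ cb * P.2 a
  snd_le : ∀ x : Fin n → 𝕜, P.2 x ≤ ca * P.1 x

/-- The metric `d_n` on `B_n^{a,b}`: the supremum, over coefficient vectors in the unit ball
of `ℓ_∞^n`, of the maximal deviation of the two seminorms. -/
def dB {n : ℕ} (P Q : SNPair 𝕜 n) : ℝ :=
  sSup {x : ℝ | ∃ a : Fin n → 𝕜, (∀ i, ‖a i‖ ≤ 1) ∧
      x = max |P.1 a - Q.1 a| |P.2 a - Q.2 a|}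

/-- A family `E`, with `E n` a set of pairs of seminorms on `𝕜^n`; this encodes a subset of
`⋃_{n≥1} B_n^{a,b}`. -/
abbrev Fam (𝕜 : Type*) [RCLike 𝕜] : Type _ := ∀ n : ℕ, Set (SNPair 𝕜 n)

/-- `E ⊆ ⋃_n B_n^{a,b}`. -/
def SubB (ca cb : ℝ) (E : Fam 𝕜) : Prop := ∀ n, ∀ P ∈ E n, MemB ca cb P

/-- `E` is closed: each `E ∩ B_n^{a,b}` is closed in `B_n^{a,b}` for the metric `d_n`. -/
def ClosedFam (ca cb : ℝ) (E : Fam 𝕜) : Prop :=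
  ∀ n, ∀ P : SNPair 𝕜 n, MemB ca cb P →
    (∀ ε : ℝ, 0 < ε → ∃ Q ∈ E n, dB P Q < ε) → P ∈ E n

/-- The `j`-th block piece: the vector `∑_{k_j < i ≤ k_{j+1}} a_i e_i` (with `0`-based
indexing of the cut points `k`). -/
def piece {n m : ℕ} (a : Fin n → 𝕜) (k : Fin (m + 1) → ℕ) (j : Fin m) : Fin n → 𝕜 :=
  fun i => if k j.castSucc ≤ (i : ℕ) ∧ (i : ℕ) < k j.succ then a i else 0

/-- `(s,σ) = Q` is a block of `(r,ρ) = P`. -/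
def IsBlockOf {n m : ℕ} (P : SNPair 𝕜 n) (Q : SNPair 𝕜 m) : Prop :=
  ∃ (a : Fin n → 𝕜) (k : Fin (m + 1) → ℕ),
    k 0 = 0 ∧ StrictMono k ∧ k (Fin.last m) ≤ n ∧
    (∀ j : Fin m, P.1 (piece a k j) = 1) ∧
    (∀ b : Fin m → 𝕜, Q.1 b = P.1 (∑ j : Fin m, b j • piece a k j)) ∧
    (∀ b : Fin m → 𝕜, Q.2 b = P.2 (∑ j : Fin m, b j • piece a k j))

/-- `E` contains all blocks of its members (that lie in the corresponding `B_m^{a,b}`). -/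
def BlockClosedFam (ca cb : ℝ) (E : Fam 𝕜) : Prop :=
  ∀ n m : ℕ, ∀ P ∈ E n, ∀ Q : SNPair 𝕜 m, MemB ca cb Q → IsBlockOf P Q → Q ∈ E m

/-- `E ⊆ ⋃_n B_n^{a,b}` is stable: closed and block closed. -/
def StableFam (ca cb : ℝ) (E : Fam 𝕜) : Prop :=
  SubB ca cb E ∧ ClosedFam ca cb E ∧ BlockClosedFam ca cb E

/-- `E` is an identity block: stable and `r = ρ` for each member. -/
def IdentityBlockFam (ca cb : ℝ) (E : Fam 𝕜) : Prop :=
  StableFam ca cb E ∧ ∀ n, ∀ P ∈ E n, P.1 = P.2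

/-- The `ℓ_p^n` norm of a coefficient vector, `1 ≤ p ≤ ∞`. -/
def lpnorm (p : ℝ≥0∞) {n : ℕ} (a : Fin n → 𝕜) : ℝ :=
  if p = ∞ then ⨆ i, ‖a i‖ else (∑ i, ‖a i‖ ^ p.toReal) ^ (1 / p.toReal)

/-- The sign `±1 ∈ 𝕜` associated to a Boolean. -/
def sgn (b : Bool) : 𝕜 := if b then 1 else -1

/-- The `L_p` norm of a real function of `n` independent Rademacher variables, i.e. of a
function on `{±1}^n` with the uniform probability measure. -/
def radLp (p : ℝ≥0∞) {n : ℕ} (F : (Fin n → Bool) → ℝ) : ℝ :=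
  if p = ∞ then ⨆ ε : Fin n → Bool, |F ε|
  else ((∑ ε : Fin n → Bool, |F ε| ^ p.toReal) / 2 ^ n) ^ (1 / p.toReal)

/-- `α_{p,n}(E)`: the infimum of the constants `T > 0` such that
`ρ(∑ a_i e_i) ≤ T ‖(a_i)‖_{ℓ_p^n}` for all `(r,ρ) ∈ E ∩ B_n^{a,b}`. -/
def alphaC (p : ℝ≥0∞) (E : Fam 𝕜) (n : ℕ) : ℝ :=
  sInf {T : ℝ | 0 < T ∧ ∀ P ∈ E n, ∀ a : Fin n → 𝕜, P.2 a ≤ T * lpnorm p a}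

/-- `β_{q,n}(E)`: the infimum of the constants `C > 0` such that
`C r(∑ a_i e_i) ≥ ‖(a_i ρ(e_i))‖_{ℓ_q^n}` for all `(r,ρ) ∈ E ∩ B_n^{a,b}`. -/
def betaC (q : ℝ≥0∞) (E : Fam 𝕜) (n : ℕ) : ℝ :=
  sInf {C : ℝ | 0 < C ∧ ∀ P ∈ E n, ∀ a : Fin n → 𝕜,
    lpnorm q (fun i => a i * ((P.2 (Pi.single i 1) : ℝ) : 𝕜)) ≤ C * P.1 a}

/-- `τ_{p,n}(E)`: the infimum of the constants `T > 0` such that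
`‖ρ(∑ ε_i a_i e_i)‖_{L_p} ≤ T ‖(a_i)‖_{ℓ_p^n}` for all `(r,ρ) ∈ E ∩ B_n^{a,b}`. -/
def tauC (p : ℝ≥0∞) (E : Fam 𝕜) (n : ℕ) : ℝ :=
  sInf {T : ℝ | 0 < T ∧ ∀ P ∈ E n, ∀ a : Fin n → 𝕜,
    radLp p (fun ε => P.2 (fun i => sgn (ε i) * a i)) ≤ T * lpnorm p a}

/-- `γ_{q,n}(E)`: the infimum of the constants `C > 0` such that
`C ‖r(∑ ε_i a_i e_i)‖_{L_q} ≥ ‖(a_i ρ(e_i))‖_{ℓ_q^n}` for all `(r,ρ) ∈ E ∩ B_n^{a,b}`. -/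
def gammaC (q : ℝ≥0∞) (E : Fam 𝕜) (n : ℕ) : ℝ :=
  sInf {C : ℝ | 0 < C ∧ ∀ P ∈ E n, ∀ a : Fin n → 𝕜,
    lpnorm q (fun i => a i * ((P.2 (Pi.single i 1) : ℝ) : 𝕜)) ≤
      C * radLp q (fun ε => P.1 (fun i => sgn (ε i) * a i))}

/-- `θ_n(E)`: the infimum of the constants `T > 0` such that
`ρ((1/n) ∑ a_i e_i) ≤ T ‖(a_i)‖_{ℓ_∞^n}` for all `(r,ρ) ∈ E ∩ B_n^{a,b}`. -/
def thetaC (E : Fam 𝕜) (n : ℕ) : ℝ :=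
  sInf {T : ℝ | 0 < T ∧ ∀ P ∈ E n, ∀ a : Fin n → 𝕜,
    P.2 ((n : 𝕜)⁻¹ • a) ≤ T * lpnorm ∞ a}

/-- `Θ_n(E)`: the infimum of the constants `T > 0` such that
`‖ρ((1/n) ∑ ε_i a_i e_i)‖_{L_1} ≤ T ‖(a_i)‖_{ℓ_∞^n}` for all `(r,ρ) ∈ E ∩ B_n^{a,b}`. -/
def bigThetaC (E : Fam 𝕜) (n : ℕ) : ℝ :=
  sInf {T : ℝ | 0 < T ∧ ∀ P ∈ E n, ∀ a : Fin n → 𝕜,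
    radLp 1 (fun ε => P.2 ((n : 𝕜)⁻¹ • fun i => sgn (ε i) * a i)) ≤ T * lpnorm ∞ a}

/-- `υ_n(E)`: the infimum of the constants `C > 0` such that
`C r(∑ a_i e_i) ≥ min_i |a_i| ρ(e_i)` for all `(r,ρ) ∈ E ∩ B_n^{a,b}`. -/
def upsC (E : Fam 𝕜) (n : ℕ) : ℝ :=
  sInf {C : ℝ | 0 < C ∧ ∀ P ∈ E n, ∀ a : Fin n → 𝕜,
    (⨅ i, ‖a i‖ * P.2 (Pi.single i 1)) ≤ C * P.1 a}

/-- `Υ_n(E)`: the infimum of the constants `C > 0` such that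
`C ‖r(∑ ε_i a_i e_i)‖_{L_1} ≥ min_i |a_i| ρ(e_i)` for all `(r,ρ) ∈ E ∩ B_n^{a,b}`. -/
def bigUpsC (E : Fam 𝕜) (n : ℕ) : ℝ :=
  sInf {C : ℝ | 0 < C ∧ ∀ P ∈ E n, ∀ a : Fin n → 𝕜,
    (⨅ i, ‖a i‖ * P.2 (Pi.single i 1)) ≤
      C * radLp 1 (fun ε => P.1 (fun i => sgn (ε i) * a i))}

end AsymSeminorms

namespace AsymSeminorms

/-- A `ϱ`-`c₀`-sequence: `ρ(e_i) ≥ ϱ` for all `i`, and `ϱ·r(∑ a_i e_i) ≤ 1` for every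
`(a_i)` in the unit ball of `ℓ_∞^n`. -/
def IsC0Seq {𝕜 : Type*} [RCLike 𝕜] (ϱ : ℝ) {n : ℕ} (P : SNPair 𝕜 n) : Prop :=
  (∀ i : Fin n, ϱ ≤ P.2 (Pi.single i 1)) ∧
  ∀ a : Fin n → 𝕜, (∀ i, ‖a i‖ ≤ 1) → ϱ * P.1 a ≤ 1

section

variable {𝕜 : Type*} [RCLike 𝕜]

/-- The pair of seminorms on `𝕜^m` obtained by substituting the vectors `y j` for the basis. -/
def subst {n m : ℕ} (P : SNPair 𝕜 n) (y : Fin m → Fin n → 𝕜) : SNPair 𝕜 m :=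
  (P.1.comp (Fintype.linearCombination 𝕜 y), P.2.comp (Fintype.linearCombination 𝕜 y))

/-- The vectors `y j` are successive, with `y j` supported in `(φ (j - 1), φ j]`. -/
structure Successive {n m : ℕ} (φ : Fin m → Fin n) (y : Fin m → Fin n → 𝕜) : Prop where
  mono : StrictMono φ
  le : ∀ j i, y j i ≠ 0 → i ≤ φ j
  lt : ∀ j i, y j i ≠ 0 → ∀ j' < j, φ j' < i

theorem subst_fst {n m : ℕ} (P : SNPair 𝕜 n) (y : Fin m → Fin n → 𝕜) (b : Fin m → 𝕜) :
    (subst P y).1 b = P.1 (∑ j, b j • y j) := by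
  simp [subst, Fintype.linearCombination_apply]

theorem subst_snd {n m : ℕ} (P : SNPair 𝕜 n) (y : Fin m → Fin n → 𝕜) (b : Fin m → 𝕜) :
    (subst P y).2 b = P.2 (∑ j, b j • y j) := by
  simp [subst, Fintype.linearCombination_apply]

theorem sum_single_smul {n m : ℕ} (y : Fin m → Fin n → 𝕜) (j : Fin m) :
    ∑ j', (Pi.single j (1 : 𝕜) : Fin m → 𝕜) j' • y j' = y j := by
  rw [Finset.sum_eq_single j]
  · simp
  · intro b _ hb; simp [hb]
  · simp

theorem subst_fst_single {n m : ℕ} (P : SNPair 𝕜 n) (y : Fin m → Fin n → 𝕜) (j : Fin m) :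
    (subst P y).1 (Pi.single j 1) = P.1 (y j) := by
  rw [subst_fst, sum_single_smul]

theorem subst_snd_single {n m : ℕ} (P : SNPair 𝕜 n) (y : Fin m → Fin n → 𝕜) (j : Fin m) :
    (subst P y).2 (Pi.single j 1) = P.2 (y j) := by
  rw [subst_snd, sum_single_smul]

namespace Successive

variable {n m : ℕ} {φ : Fin m → Fin n} {y : Fin m → Fin n → 𝕜}

theorem unique (h : Successive φ y) {j j' : Fin m} {i : Fin n} (h1 : y j i ≠ 0)
    (h2 : y j' i ≠ 0) : j = j' := by
  rcases lt_trichotomy j j' with hlt | heq | hgt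
  · exact absurd (h.le _ _ h1) (not_le.2 (h.lt _ _ h2 _ hlt))
  · exact heq
  · exact absurd (h.le _ _ h2) (not_le.2 (h.lt _ _ h1 _ hgt))

theorem sum_apply (h : Successive φ y) {j : Fin m} {i : Fin n} (h1 : y j i ≠ 0)
    (b : Fin m → 𝕜) : (∑ j', b j' • y j') i = b j * y j i := by
  rw [Finset.sum_apply, Finset.sum_eq_single j]
  · simp
  · intro j' _ hj'
    have : y j' i = 0 := by
      by_contra h2
      exact hj' (h.unique h2 h1)
    simp [this]
  · simp

theorem sum_apply_eq_zero {i : Fin n} (h1 : ∀ j, y j i = 0) (b : Fin m → 𝕜) :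
    (∑ j', b j' • y j') i = 0 := by
  simp [Finset.sum_apply, h1]

theorem norm_sum_le (h : Successive φ y) (hy : ∀ j, ‖y j‖ ≤ 1) (b : Fin m → 𝕜) :
    ‖∑ j, b j • y j‖ ≤ ‖b‖ := by
  refine (pi_norm_le_iff_of_nonneg (norm_nonneg _)).2 fun i => ?_
  by_cases hi : ∀ j, y j i = 0
  · rw [sum_apply_eq_zero hi]; simp
  · push Not at hi
    obtain ⟨j, hj⟩ := hi
    rw [h.sum_apply hj, norm_mul]
    calc ‖b j‖ * ‖y j i‖ ≤ ‖b‖ * 1 := by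
          gcongr
          · exact norm_le_pi_norm b j
          · exact (norm_le_pi_norm (y j) i).trans (hy j)
      _ = ‖b‖ := mul_one _

theorem smul (h : Successive φ y) (c : Fin m → 𝕜) : Successive φ (fun j => c j • y j) where
  mono := h.mono
  le := fun j i hi => h.le j i fun h0 => hi (by simp [h0])
  lt := fun j i hi => h.lt j i fun h0 => hi (by simp [h0])

theorem single {φ : Fin m → Fin n} (h : StrictMono φ) :
    Successive φ (fun j => (Pi.single (φ j) (1 : 𝕜) : Fin n → 𝕜)) := by
  have key : ∀ j i, (Pi.single (φ j) (1 : 𝕜) : Fin n → 𝕜) i ≠ 0 → i = φ j := by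
    intro j i hi
    by_contra hne
    exact hi (by simp [hne])
  exact ⟨h, fun j i hi => (key j i hi).le, fun j i hi j' hj' => by
    rw [key j i hi]; exact h hj'⟩

end Successive

theorem memB_subst {ca cb : ℝ} {n m : ℕ} {P : SNPair 𝕜 n} (hP : MemB ca cb P)
    {φ : Fin m → Fin n} {y : Fin m → Fin n → 𝕜} (h : Successive φ y)
    (hy : ∀ j, P.1 (y j) = 1) : MemB ca cb (subst P y) := by
  have htr : ∀ l : ℕ, l ≤ m → ∃ k : ℕ, k ≤ n ∧ ∀ b : Fin m → 𝕜,
      ∑ j, (trunc l b) j • y j = trunc k (∑ j, b j • y j) := by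
    intro l hl
    rcases Nat.eq_zero_or_pos l with rfl | hpos
    · exact ⟨0, Nat.zero_le _, fun b => by ext i; simp [trunc]⟩
    · let l' : Fin m := ⟨l - 1, by omega⟩
      refine ⟨(φ l' : ℕ) + 1, (φ l').2, fun b => ?_⟩
      ext i
      by_cases hi : ∀ j, y j i = 0
      · rw [Successive.sum_apply_eq_zero hi]
        simp [trunc, hi]
      · push Not at hi
        obtain ⟨j, hj⟩ := hi
        rw [h.sum_apply hj]
        simp only [trunc]
        rw [show (∑ j, b j • y j) i = b j * y j i from h.sum_apply hj b]
        by_cases hjl : (j : ℕ) < l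
        · have h1 : i ≤ φ j := h.le _ _ hj
          have h2 : φ j ≤ φ l' := h.mono.monotone (by
            rw [Fin.le_def]; show (j : ℕ) ≤ l - 1; omega)
          have : (i : ℕ) < φ l' + 1 := Nat.lt_succ_of_le (h1.trans h2)
          simp [hjl, this]
        · have h1 : φ l' < i := h.lt _ _ hj l' (by
            rw [Fin.lt_def]; show l - 1 < (j : ℕ); omega)
          have : ¬ (i : ℕ) < φ l' + 1 := by
            rw [Fin.lt_def] at h1; omega
          simp [hjl, this]
  refine ⟨?_, ?_, ?_, ?_, ?_⟩
  · intro b hb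
    rw [subst_fst] at hb
    have h0 := hP.eq_zero_of _ hb
    ext j
    have hne : y j ≠ 0 := by
      intro h0; have := hy j; rw [h0, map_zero] at this; exact zero_ne_one this
    obtain ⟨i, hi⟩ := Function.ne_iff.1 hne
    have := congrFun h0 i
    rw [h.sum_apply hi] at this
    exact (mul_eq_zero.1 this).resolve_right hi
  · intro j
    rw [subst_fst_single, hy]
  · intro l hl b
    obtain ⟨k, hk, he⟩ := htr l hl
    rw [subst_fst, subst_fst, he]
    exact hP.trunc_fst k hk _
  · intro l hl b
    obtain ⟨k, hk, he⟩ := htr l hl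
    rw [subst_snd, subst_snd, he]
    exact hP.trunc_snd k hk _
  · intro b
    rw [subst_fst, subst_snd]
    exact hP.snd_le _

theorem isBlockOf_subst {n m : ℕ} {P : SNPair 𝕜 n}
    {φ : Fin m → Fin n} {y : Fin m → Fin n → 𝕜} (h : Successive φ y)
    (hy : ∀ j, P.1 (y j) = 1) : IsBlockOf P (subst P y) := by
  have hpiece : ∀ j, piece (∑ j, y j) (Fin.cons 0 fun j => (φ j : ℕ) + 1) j = y j := by
    intro j
    ext i
    simp only [piece, Fin.cons_succ]
    by_cases hi : ∀ j, y j i = 0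
    · simp [hi]
    · push Not at hi
      obtain ⟨j₀, hj₀⟩ := hi
      have hs : (∑ j, y j) i = y j₀ i := by
        simpa using h.sum_apply hj₀ (fun _ => (1 : 𝕜))
      rw [hs]
      rcases lt_trichotomy j j₀ with hlt | heq | hgt
      · have h1 := h.lt _ _ hj₀ _ hlt
        rw [Fin.lt_def] at h1
        rw [if_neg (by omega)]
        by_contra hne
        exact hlt.ne (h.unique (Ne.symm hne) hj₀)
      · subst heq
        have h1 := h.le _ _ hj₀
        rw [Fin.le_def] at h1
        refine if_pos ⟨?_, by omega⟩
        obtain ⟨j, hjm⟩ := j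
        cases j with
        | zero => exact Nat.zero_le _
        | succ j =>
          have h2 := h.lt _ _ hj₀ ⟨j, by omega⟩ (by simp [Fin.lt_def])
          rw [Fin.lt_def] at h2
          exact h2
      · have h1 := h.le _ _ hj₀
        rw [Fin.le_def] at h1
        have : ¬ ((Fin.cons 0 (fun j => (φ j : ℕ) + 1) : Fin (m + 1) → ℕ) j.castSucc ≤ (i : ℕ)) := by
          obtain ⟨j, hjm⟩ := j
          cases j with
          | zero => simp [Fin.lt_def] at hgt
          | succ j =>
            have h2 : φ j₀ ≤ φ ⟨j, by omega⟩ := h.mono.monotone (by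
              rw [Fin.lt_def] at hgt; rw [Fin.le_def]; exact Nat.le_of_lt_succ hgt)
            rw [Fin.le_def] at h2
            show ¬ ((φ ⟨j, _⟩ : ℕ) + 1 ≤ i)
            omega
        rw [if_neg fun hh => this hh.1]
        by_contra hne
        exact hgt.ne' (h.unique (Ne.symm hne) hj₀)
  refine ⟨∑ j, y j, Fin.cons 0 fun j => (φ j : ℕ) + 1, rfl, ?_, ?_, ?_, ?_, ?_⟩
  · rw [Fin.strictMono_iff_lt_succ]
    intro j
    rw [Fin.cons_succ]
    obtain ⟨j, hjm⟩ := j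
    cases j with
    | zero => exact Nat.succ_pos _
    | succ j =>
      have h2 : φ ⟨j, by omega⟩ < φ ⟨j + 1, hjm⟩ := h.mono (by simp [Fin.lt_def])
      exact Nat.succ_lt_succ h2
  · cases m with
    | zero => exact Nat.zero_le _
    | succ m => exact (φ (Fin.last m)).2
  · intro j; rw [hpiece, hy]
  · intro b; simp_rw [hpiece]; exact subst_fst P y b
  · intro b; simp_rw [hpiece]; exact subst_snd P y b

theorem StableFam.subst_mem {ca cb : ℝ} {E : Fam 𝕜} (hE : StableFam ca cb E) {n m : ℕ}
    {P : SNPair 𝕜 n} (hP : P ∈ E n) {φ : Fin m → Fin n} {y : Fin m → Fin n → 𝕜}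
    (h : Successive φ y) (hy : ∀ j, P.1 (y j) = 1) : subst P y ∈ E m :=
  hE.2.2 n m P hP _ (memB_subst (hE.1 n P hP) h hy) (isBlockOf_subst h hy)

theorem seminorm_coord_le {cb : ℝ} {n : ℕ} (p : Seminorm 𝕜 (Fin n → 𝕜))
    (hp : ∀ m : ℕ, m ≤ n → ∀ a : Fin n → 𝕜, p (trunc m a) ≤ cb * p a)
    (a : Fin n → 𝕜) (i : Fin n) : ‖a i‖ * p (Pi.single i 1) ≤ 2 * cb * p a := by
  have h1 : a i • (Pi.single i (1 : 𝕜) : Fin n → 𝕜) = trunc (i + 1) a - trunc i a := by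
    ext l
    by_cases hl : l = i
    · subst hl; simp [trunc]
    · have hl' : (l : ℕ) ≠ i := fun h => hl (Fin.ext h)
      by_cases h2 : (l : ℕ) < i
      · simp [trunc, hl, h2, Nat.lt_succ_of_lt h2]
      · have : ¬ (l : ℕ) < i + 1 := by omega
        simp [trunc, hl, h2, this]
  rw [← map_smul_eq_mul, h1]
  calc p (trunc (i + 1) a - trunc i a) ≤ p (trunc (i + 1) a) + p (trunc i a) := map_sub_le_add _ _ _
    _ ≤ cb * p a + cb * p a := add_le_add (hp _ i.2 a) (hp _ i.2.le a)
    _ = 2 * cb * p a := by ring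

theorem sum_smul_single_apply {n m : ℕ} {φ : Fin m → Fin n} (h : StrictMono φ) (b : Fin m → 𝕜)
    (j : Fin m) : (∑ l, b l • (Pi.single (φ l) (1 : 𝕜) : Fin n → 𝕜)) (φ j) = b j := by
  rw [(Successive.single (𝕜 := 𝕜) h).sum_apply (j := j) (i := φ j) (by simp) b]
  simp

theorem norm_sum_smul_single {n m : ℕ} {φ : Fin m → Fin n} (h : StrictMono φ) (b : Fin m → 𝕜) :
    ‖∑ l, b l • (Pi.single (φ l) (1 : 𝕜) : Fin n → 𝕜)‖ = ‖b‖ := by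
  refine le_antisymm ((Successive.single h).norm_sum_le (fun j => ?_) b) ?_
  · rw [Pi.norm_single, norm_one]
  · refine (pi_norm_le_iff_of_nonneg (norm_nonneg _)).2 fun j => ?_
    rw [← sum_smul_single_apply h b j]
    exact norm_le_pi_norm _ _

/-- James' argument: in a hereditary family of pairs whose (compatibly chosen) seminorms `f` are
uniformly dominated by the sup norm, there are arbitrarily long successive sup-normalised vectors
on which `f` almost attains its optimal constant `K`. -/
theorem exists_successive_almost_extremal (C : ∀ n, Set (SNPair 𝕜 n))
    (hne : ∀ n, (C n).Nonempty)
    (hres : ∀ (n m : ℕ) (φ : Fin m → Fin n), StrictMono φ → ∀ P ∈ C n,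
      subst P (fun j => Pi.single (φ j) 1) ∈ C m)
    (f : ∀ n, SNPair 𝕜 n → Seminorm 𝕜 (Fin n → 𝕜))
    (hf : ∀ (n m : ℕ) (P : SNPair 𝕜 n) (y : Fin m → Fin n → 𝕜) (b : Fin m → 𝕜),
      f m (subst P y) b = f n P (∑ j, b j • y j))
    (B κ : ℝ) (hB : ∀ n, ∀ P ∈ C n, ∀ a, f n P a ≤ B * ‖a‖)
    (hκ : ∀ P ∈ C 1, κ ≤ f 1 P (Pi.single 0 1)) :
    ∃ K, κ ≤ K ∧ K ≤ B ∧ ∀ δ > 0, ∀ n, ∃ N, ∃ P ∈ C N, ∃ (φ : Fin n → Fin N)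
      (y : Fin n → Fin N → 𝕜), Successive φ y ∧ (∀ j, ‖y j‖ = 1) ∧
      (∀ a, f N P a ≤ (K + δ) * ‖a‖) ∧ ∀ j, K - δ ≤ f N P (y j) := by
  let U : Set ℝ := {t | ∀ n, ∃ P ∈ C n, ∀ a, f n P a ≤ t * ‖a‖}
  have hBU : B ∈ U := fun n => (hne n).elim fun P hP => ⟨P, hP, hB n P hP⟩
  have hlow : ∀ t ∈ U, κ ≤ t := by
    intro t ht
    obtain ⟨P, hP, h⟩ := ht 1
    have := h (Pi.single 0 1)
    rw [Pi.norm_single, norm_one, mul_one] at this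
    exact (hκ P hP).trans this
  have hbdd : BddBelow U := ⟨κ, hlow⟩
  refine ⟨sInf U, le_csInf ⟨B, hBU⟩ hlow, csInf_le hbdd hBU, fun δ hδ n => ?_⟩
  set K := sInf U
  obtain ⟨t, htU, htK⟩ := exists_lt_of_csInf_lt ⟨B, hBU⟩ (show K < K + δ by linarith)
  have hnot : K - δ ∉ U := fun h => by
    have := csInf_le hbdd h
    linarith
  obtain ⟨M, hM⟩ : ∃ M, ∀ P ∈ C M, ∃ a, (K - δ) * ‖a‖ < f M P a := by
    by_contra hcon
    push Not at hcon
    exact hnot hcon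
  obtain ⟨P, hP, hPt⟩ := htU (n * M)
  have hMpos : 0 < M := by
    rcases Nat.eq_zero_or_pos M with rfl | h
    · obtain ⟨Q, hQ⟩ := hne 0
      obtain ⟨a, ha⟩ := hM Q hQ
      rw [show a = 0 from Subsingleton.elim _ _, norm_zero, mul_zero, map_zero] at ha
      exact (lt_irrefl _ ha).elim
    · exact h
  let pr : Fin n → Fin M → Fin (n * M) := fun j l => finProdFinEquiv (j, l)
  have hval : ∀ j l, (pr j l : ℕ) = l + M * j := fun j l => by simp [pr]
  have hpr : ∀ j, StrictMono (pr j) := fun j l l' h => by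
    rw [Fin.lt_def] at h ⊢; rw [hval, hval]; omega
  have hprlt : ∀ j j', j < j' → ∀ l l', pr j l < pr j' l' := fun j j' h l l' => by
    rw [Fin.lt_def] at h ⊢
    rw [hval, hval]
    have h1 : M * ((j : ℕ) + 1) ≤ M * j' := Nat.mul_le_mul_left _ h
    have := l.2
    rw [Nat.mul_succ] at h1
    omega
  have hsub : ∀ j, ∃ a : Fin M → 𝕜, ‖a‖ = 1 ∧
      K - δ ≤ f (n * M) P (∑ l, a l • Pi.single (pr j l) 1) := by
    intro j
    obtain ⟨a, ha⟩ := hM _ (hres _ _ (pr j) (hpr j) P hP)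
    rw [hf] at ha
    have ha0 : a ≠ 0 := by
      rintro rfl
      simp at ha
    have hpos : 0 < ‖a‖ := norm_pos_iff.2 ha0
    refine ⟨((‖a‖⁻¹ : ℝ) : 𝕜) • a, ?_, ?_⟩
    · rw [norm_smul, RCLike.norm_ofReal, abs_of_pos (inv_pos.2 hpos), inv_mul_cancel₀ hpos.ne']
    · have : ∑ l, (((‖a‖⁻¹ : ℝ) : 𝕜) • a) l • (Pi.single (pr j l) (1 : 𝕜) : Fin (n * M) → 𝕜) =
          ((‖a‖⁻¹ : ℝ) : 𝕜) • ∑ l, a l • (Pi.single (pr j l) (1 : 𝕜) : Fin (n * M) → 𝕜) := by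
        simp [Finset.smul_sum, mul_smul]
      rw [this, map_smul_eq_mul, RCLike.norm_ofReal, abs_of_pos (inv_pos.2 hpos),
        inv_mul_eq_div, le_div_iff₀ hpos]
      exact ha.le
  choose a ha1 haK using hsub
  let y : Fin n → Fin (n * M) → 𝕜 := fun j => ∑ l, a j l • Pi.single (pr j l) 1
  have hsupp : ∀ j i, y j i ≠ 0 → ∃ l, i = pr j l := by
    intro j i hi
    by_contra hcon
    push Not at hcon
    apply hi
    simp only [y, Finset.sum_apply]
    refine Finset.sum_eq_zero fun l _ => ?_
    simp [hcon l]
  let last : Fin M := ⟨M - 1, by omega⟩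
  refine ⟨n * M, P, hP, fun j => pr j last, y, ⟨?_, ?_, ?_⟩, ?_, ?_, haK⟩
  · exact fun j j' h => hprlt j j' h _ _
  · intro j i hi
    obtain ⟨l, rfl⟩ := hsupp j i hi
    exact (hpr j).monotone (by rw [Fin.le_def]; show (l : ℕ) ≤ M - 1; omega)
  · intro j i hi j' hj'
    obtain ⟨l, rfl⟩ := hsupp j i hi
    exact hprlt _ _ hj' _ _
  · intro j
    simp only [y]
    rw [norm_sum_smul_single (hpr j), ha1]
  · exact fun x => (hPt x).trans (by gcongr)

/-- The pairs in `E n` which are dominated by `B` times the sup norm, and for which `ρ` is at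
least `κ` on the basis. -/
def c0Class (E : Fam 𝕜) (B κ : ℝ) (n : ℕ) : Set (SNPair 𝕜 n) :=
  {P | P ∈ E n ∧ (∀ a, P.1 a ≤ B * ‖a‖) ∧ ∀ i, κ ≤ P.2 (Pi.single i 1)}

theorem c0Class_subst {ca cb : ℝ} {E : Fam 𝕜} (hE : StableFam ca cb E) {B κ : ℝ} (n m : ℕ)
    (φ : Fin m → Fin n) (h : StrictMono φ) (P : SNPair 𝕜 n) (hP : P ∈ c0Class E B κ n) :
    subst P (fun j => Pi.single (φ j) 1) ∈ c0Class E B κ m := by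
  refine ⟨hE.subst_mem hP.1 (Successive.single h) fun j => (hE.1 n P hP.1).single_eq_one _,
    fun a => ?_, fun i => ?_⟩
  · rw [subst_fst]
    exact (hP.2.1 _).trans_eq (by rw [norm_sum_smul_single h])
  · rw [subst_snd_single]
    exact hP.2.2 _

theorem seminorm_lower_of_upper {n : ℕ} (p : Seminorm 𝕜 (Fin n → 𝕜)) {U V : ℝ}
    (hV : 0 ≤ V)
    (hU : ∀ a, p a ≤ U * ‖a‖) (hp : ∀ i, V ≤ p (Pi.single i 1)) (a : Fin n → 𝕜) :
    (2 * V - U) * ‖a‖ ≤ p a := by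
  rcases isEmpty_or_nonempty (Fin n) with hn | hn
  · rw [Subsingleton.elim a 0]; simp
  obtain ⟨i, hi⟩ : ∃ i, ‖a‖ = ‖a i‖ := by
    obtain ⟨i, hi⟩ := Finite.exists_max fun i => ‖a i‖
    exact ⟨i, le_antisymm ((pi_norm_le_iff_of_nonneg (norm_nonneg _)).2 hi) (norm_le_pi_norm a i)⟩
  let c : Fin n → 𝕜 := a - (2 * a i) • Pi.single i 1
  have hc : ‖c‖ ≤ ‖a‖ := by
    refine (pi_norm_le_iff_of_nonneg (norm_nonneg _)).2 fun l => ?_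
    by_cases hl : l = i
    · subst hl
      have : c l = - a l := by simp [c]; ring
      rw [this, norm_neg]; exact norm_le_pi_norm a l
    · have : c l = a l := by simp [c, hl]
      rw [this]; exact norm_le_pi_norm a l
  have h1 : p ((2 * a i) • Pi.single i 1) = 2 * ‖a‖ * p (Pi.single i 1) := by
    rw [map_smul_eq_mul, norm_mul, hi, RCLike.norm_ofNat]
  have h2 : p ((2 * a i) • Pi.single i 1) ≤ p a + p c := by
    have : (2 * a i) • (Pi.single i 1 : Fin n → 𝕜) = a - c := by simp [c]
    rw [this]
    exact map_sub_le_add _ _ _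
  have h3 := hU c
  have h4 : V * ‖a‖ ≤ p (Pi.single i 1) * ‖a‖ := by gcongr; exact hp i
  have h5 : U * ‖c‖ ≤ U * ‖a‖ := by
    have hU0 : 0 ≤ U := by
      have := (hp i).trans (hU _)
      rw [Pi.norm_single, norm_one, mul_one] at this
      linarith
    gcongr
  linarith

/-- Normalising the vectors `y j` to have `r`-norm one. -/
theorem exists_normalized {ca cb : ℝ} {E : Fam 𝕜} (hE : StableFam ca cb E) {n N : ℕ}
    {P : SNPair 𝕜 N} (hP : P ∈ E N) {φ : Fin n → Fin N} {y : Fin n → Fin N → 𝕜}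
    (h : Successive φ y) {s : ℝ} (hs0 : 0 < s) (hs : ∀ j, s ≤ P.1 (y j)) :
    ∃ Q ∈ E n, (∀ j, Q.2 (Pi.single j 1) = P.2 (y j) / P.1 (y j)) ∧
      ∀ b : Fin n → 𝕜, ∃ b' : Fin n → 𝕜, ‖b'‖ ≤ ‖b‖ / s ∧ Q.1 b = P.1 (∑ j, b' j • y j) ∧
        Q.2 b = P.2 (∑ j, b' j • y j) := by
  have hpos : ∀ j, 0 < P.1 (y j) := fun j => hs0.trans_le (hs j)
  have hnorm : ∀ j, ‖(((P.1 (y j))⁻¹ : ℝ) : 𝕜)‖ = (P.1 (y j))⁻¹ := fun j => by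
    rw [RCLike.norm_ofReal, abs_of_pos (inv_pos.2 (hpos j))]
  refine ⟨subst P (fun j => (((P.1 (y j))⁻¹ : ℝ) : 𝕜) • y j), hE.subst_mem hP (h.smul _) ?_,
    ?_, fun b => ⟨fun j => b j * (((P.1 (y j))⁻¹ : ℝ) : 𝕜), ?_, ?_, ?_⟩⟩
  · intro j
    rw [map_smul_eq_mul, hnorm, inv_mul_cancel₀ (hpos j).ne']
  · intro j
    rw [subst_snd_single, map_smul_eq_mul, hnorm, inv_mul_eq_div]
  · refine (pi_norm_le_iff_of_nonneg (by positivity)).2 fun j => ?_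
    rw [norm_mul, hnorm, div_eq_mul_inv]
    gcongr
    · exact norm_le_pi_norm b j
    · exact hs j
  · rw [subst_fst]; simp only [mul_smul]
  · rw [subst_snd]; simp only [mul_smul]

theorem exists_c0Class_near_one {ca cb : ℝ} (hcb : 1 ≤ cb) {E : Fam 𝕜}
    (hE : StableFam ca cb E) {ϱ : ℝ} (hϱ : 0 < ϱ)
    (h : ∀ n, (c0Class E (1 / ϱ) ϱ n).Nonempty) :
    ∃ κ > 0, ∀ δ > 0, ∀ n, (c0Class E (1 + δ) κ n).Nonempty := by
  obtain ⟨K, hK1, -, hK⟩ := exists_successive_almost_extremal (c0Class E (1 / ϱ) ϱ) h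
    (c0Class_subst hE) (fun _ P => P.1) (fun _ _ P y b => subst_fst P y b) (1 / ϱ) 1
    (fun n P hP => hP.2.1) (fun P hP => ((hE.1 _ P hP.1).single_eq_one 0).ge)
  refine ⟨ϱ ^ 2 / (2 * cb), by positivity, fun δ hδ n => ?_⟩
  obtain ⟨δ', hδ'0, hδ'1, hδ'2⟩ : ∃ δ' > 0, δ' ≤ δ / 4 ∧ δ' ≤ 1 / 2 :=
    ⟨min (δ / 4) (1 / 2), by positivity, min_le_left _ _, min_le_right _ _⟩
  obtain ⟨N, P, hP, φ, y, hS, hy1, hup, hlo⟩ := hK δ' hδ'0 n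
  have hs0 : 0 < K - δ' := by linarith
  obtain ⟨Q, hQ, hQ2, hQb⟩ := exists_normalized hE hP.1 hS hs0 hlo
  refine ⟨Q, hQ, fun b => ?_, fun j => ?_⟩
  · obtain ⟨b', hb', h1, -⟩ := hQb b
    rw [h1]
    calc P.1 (∑ j, b' j • y j) ≤ (K + δ') * ‖∑ j, b' j • y j‖ := hup _
      _ ≤ (K + δ') * (‖b‖ / (K - δ')) := by
          have := hS.norm_sum_le (fun j => (hy1 j).le) b'
          have h0 : 0 ≤ K + δ' := by linarith
          gcongr
          exact this.trans hb'
      _ = (K + δ') / (K - δ') * ‖b‖ := by ring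
      _ ≤ (1 + δ) * ‖b‖ := by
          gcongr
          rw [div_le_iff₀ hs0]
          nlinarith
  · rw [hQ2]
    have hpos : 0 < P.1 (y j) := hs0.trans_le (hlo j)
    have hle : P.1 (y j) ≤ 1 / ϱ := by simpa [hy1 j] using hP.2.1 (y j)
    have hco : ∀ i, ‖y j i‖ ≤ 2 * cb * P.2 (y j) / ϱ := fun i => by
      rw [le_div_iff₀ hϱ]
      refine le_trans ?_ (seminorm_coord_le P.2 (hE.1 _ P hP.1).trunc_snd (y j) i)
      gcongr
      exact hP.2.2 i
    have h1 : ‖y j‖ ≤ 2 * cb * P.2 (y j) / ϱ :=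
      (pi_norm_le_iff_of_nonneg (by positivity)).2 hco
    rw [hy1, le_div_iff₀ hϱ, one_mul] at h1
    rw [le_div_iff₀ hpos, div_mul_eq_mul_div, div_le_iff₀ (by positivity)]
    calc ϱ ^ 2 * P.1 (y j) ≤ ϱ ^ 2 * (1 / ϱ) := by gcongr
      _ = ϱ := by field_simp
      _ ≤ _ := by linarith

theorem exists_almost_isometric {ca cb : ℝ} (hca : 0 ≤ ca) {E : Fam 𝕜}
    (hE : StableFam ca cb E) {κ : ℝ} (hκ : 0 < κ)
    (h : ∀ δ > 0, ∀ n, (c0Class E (1 + δ) κ n).Nonempty) {η : ℝ} (hη : 0 < η) :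
    ∃ K, κ ≤ K ∧ K ≤ 2 * ca ∧ ∀ n, ∃ Q ∈ E n, ∀ b,
      |Q.1 b - ‖b‖| ≤ η * ‖b‖ ∧ |Q.2 b - K * ‖b‖| ≤ η * ‖b‖ := by
  obtain ⟨δ, hδ0, hδ1, hδ2⟩ : ∃ δ > 0, δ ≤ 1 / 2 ∧ 4 * (2 * ca + 1) * δ ≤ η := by
    refine ⟨min (1 / 2) (η / (4 * (2 * ca + 1))), by positivity, min_le_left _ _, ?_⟩
    calc 4 * (2 * ca + 1) * min (1 / 2) (η / (4 * (2 * ca + 1)))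
        ≤ 4 * (2 * ca + 1) * (η / (4 * (2 * ca + 1))) := by
          gcongr; exact min_le_right _ _
      _ = η := by field_simp
  obtain ⟨K, hK1, hK2, hK⟩ := exists_successive_almost_extremal (c0Class E (1 + δ) κ) (h δ hδ0)
    (c0Class_subst hE) (fun _ P => P.2) (fun _ _ P y b => subst_snd P y b) (ca * (1 + δ)) κ
    (fun n P hP a => ((hE.1 _ P hP.1).snd_le a).trans (by
      rw [mul_assoc]; exact mul_le_mul_of_nonneg_left (hP.2.1 a) hca))
    (fun P hP => hP.2.2 0)
  have hKca : K ≤ 2 * ca := by nlinarith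
  have hKδ : 4 * (K + 1) * δ ≤ η := by nlinarith
  refine ⟨K, hK1, hKca, fun n => ?_⟩
  obtain ⟨N, P, hP, φ, y, hS, hy1, hup, hlo⟩ := hK δ hδ0 n
  have hs0 : 0 < 1 - δ := by linarith
  have hs : ∀ j, 1 - δ ≤ P.1 (y j) := fun j => by
    have := seminorm_lower_of_upper P.1 (V := 1) zero_le_one hP.2.1
      (fun i => ((hE.1 _ P hP.1).single_eq_one i).ge) (y j)
    rw [hy1] at this
    linarith
  have hs' : ∀ j, P.1 (y j) ≤ 1 + δ := fun j => by simpa [hy1 j] using hP.2.1 (y j)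
  obtain ⟨Q, hQ, hQ2, hQb⟩ := exists_normalized hE hP.1 hS hs0 hs
  have hy' : ∀ b' : Fin n → 𝕜, ‖∑ j, b' j • y j‖ ≤ ‖b'‖ :=
    fun b' => hS.norm_sum_le (fun j => (hy1 j).le) b'
  have hKpos : 0 < K := hκ.trans_le hK1
  have hU1 : ∀ b, Q.1 b ≤ (1 + 4 * δ) * ‖b‖ := fun b => by
    obtain ⟨b', hb', h1, -⟩ := hQb b
    rw [h1]
    calc P.1 (∑ j, b' j • y j) ≤ (1 + δ) * ‖∑ j, b' j • y j‖ := hP.2.1 _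
      _ ≤ (1 + δ) * (‖b‖ / (1 - δ)) := by
          gcongr
          exact (hy' b').trans hb'
      _ = (1 + δ) / (1 - δ) * ‖b‖ := by ring
      _ ≤ (1 + 4 * δ) * ‖b‖ := by
          gcongr
          rw [div_le_iff₀ hs0]
          nlinarith
  have hU2 : ∀ b, Q.2 b ≤ (K + 2 * (K + 1) * δ) * ‖b‖ := fun b => by
    obtain ⟨b', hb', -, h1⟩ := hQb b
    rw [h1]
    calc P.2 (∑ j, b' j • y j) ≤ (K + δ) * ‖∑ j, b' j • y j‖ := hup _
      _ ≤ (K + δ) * (‖b‖ / (1 - δ)) := by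
          gcongr
          exact (hy' b').trans hb'
      _ = (K + δ) / (1 - δ) * ‖b‖ := by ring
      _ ≤ _ := by
          gcongr
          rw [div_le_iff₀ hs0]
          have : 0 ≤ (K + 1) * δ * (1 - 2 * δ) :=
            mul_nonneg (by positivity) (by linarith)
          nlinarith
  have hL2 : ∀ j, max 0 (K - (K + 1) * δ) ≤ Q.2 (Pi.single j 1) := fun j => by
    refine max_le (apply_nonneg _ _) ?_
    have hpos : 0 < P.1 (y j) := hs0.trans_le (hs j)
    rw [hQ2, le_div_iff₀ hpos]
    rcases le_or_gt 0 (K - (K + 1) * δ) with h0 | h0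
    · calc (K - (K + 1) * δ) * P.1 (y j) ≤ (K - (K + 1) * δ) * (1 + δ) := by
            gcongr; exact hs' j
        _ ≤ K - δ := by nlinarith [mul_pos (mul_pos hδ0 hδ0) (show 0 < K + 1 by linarith)]
        _ ≤ _ := hlo j
    · exact (mul_nonpos_of_nonpos_of_nonneg h0.le hpos.le).trans (apply_nonneg _ _)
  refine ⟨Q, hQ, fun b => ⟨?_, ?_⟩⟩
  · have h1 := seminorm_lower_of_upper Q.1 (V := 1) zero_le_one hU1
      (fun i => ((hE.1 _ Q hQ).single_eq_one i).ge) b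
    have h2 := hU1 b
    have h3 : 4 * δ * ‖b‖ ≤ η * ‖b‖ := by gcongr; nlinarith
    rw [abs_le]
    constructor <;> nlinarith
  · have h1 := seminorm_lower_of_upper Q.2 (le_max_left _ _) hU2 hL2 b
    have h2 := hU2 b
    have h3 : 4 * (K + 1) * δ * ‖b‖ ≤ η * ‖b‖ := by gcongr
    have h4 : 2 * (K + 1) * δ * ‖b‖ ≤ 4 * (K + 1) * δ * ‖b‖ := by gcongr; norm_num
    have h5 : (2 * (K - (K + 1) * δ) - (K + 2 * (K + 1) * δ)) * ‖b‖ ≤ Q.2 b := by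
      refine le_trans ?_ h1
      gcongr
      exact le_max_right _ _
    rw [abs_le]
    constructor <;> nlinarith

theorem norm_trunc_le {n : ℕ} (m : ℕ) (a : Fin n → 𝕜) : ‖trunc m a‖ ≤ ‖a‖ := by
  refine (pi_norm_le_iff_of_nonneg (norm_nonneg _)).2 fun i => ?_
  simp only [trunc]
  split_ifs
  · exact norm_le_pi_norm a i
  · simp

theorem lpnorm_top {n : ℕ} (a : Fin n → 𝕜) : lpnorm ∞ a = ‖a‖ := by
  simp only [lpnorm, if_true]
  refine le_antisymm (Real.iSup_le (norm_le_pi_norm a) (norm_nonneg _)) ?_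
  refine (pi_norm_le_iff_of_nonneg (Real.iSup_nonneg fun i => norm_nonneg _)).2 fun i => ?_
  exact le_ciSup (f := fun i => ‖a i‖) (Set.finite_range _).bddAbove i

/-- The pair `(‖·‖_∞, c ‖·‖_∞)`. -/
def supPair (𝕜 : Type*) [RCLike 𝕜] (c : NNReal) (n : ℕ) : SNPair 𝕜 n :=
  (normSeminorm 𝕜 (Fin n → 𝕜), c • normSeminorm 𝕜 (Fin n → 𝕜))

theorem supPair_fst (c : NNReal) {n : ℕ} (a : Fin n → 𝕜) : (supPair 𝕜 c n).1 a = ‖a‖ := rfl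

theorem supPair_snd (c : NNReal) {n : ℕ} (a : Fin n → 𝕜) :
    (supPair 𝕜 c n).2 a = c * ‖a‖ := rfl

theorem memB_supPair {ca cb : ℝ} (hcb : 1 ≤ cb) {c : NNReal} (hc : (c : ℝ) ≤ ca) (n : ℕ) :
    MemB ca cb (supPair 𝕜 c n) := by
  have key : ∀ (m : ℕ) (a : Fin n → 𝕜), ‖trunc m a‖ ≤ cb * ‖a‖ := fun m a =>
    (norm_trunc_le m a).trans (le_mul_of_one_le_left (norm_nonneg _) hcb)
  refine ⟨fun x hx => ?_, fun i => ?_, fun m _ a => ?_, fun m _ a => ?_, fun x => ?_⟩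
  · rwa [supPair_fst, norm_eq_zero] at hx
  · rw [supPair_fst, Pi.norm_single, norm_one]
  · exact key m a
  · rw [supPair_snd, supPair_snd, mul_left_comm]
    exact mul_le_mul_of_nonneg_left (key m a) c.2
  · rw [supPair_fst, supPair_snd]
    gcongr

theorem exists_supPair_mem {ca cb : ℝ} (hcb : 1 ≤ cb) {E : Fam 𝕜}
    (hE : StableFam ca cb E) {κ : ℝ} (hκ : 0 < κ)
    (h : ∀ η > 0, ∃ K, κ ≤ K ∧ K ≤ 2 * ca ∧ ∀ n, ∃ Q ∈ E n, ∀ b,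
      |Q.1 b - ‖b‖| ≤ η * ‖b‖ ∧ |Q.2 b - K * ‖b‖| ≤ η * ‖b‖) :
    ∃ c : NNReal, 0 < c ∧ ∀ n, supPair 𝕜 c n ∈ E n := by
  choose! K hK1 hK2 hK using h
  let η : ℕ → ℝ := fun k => 1 / ((k : ℝ) + 1)
  have hη : ∀ k, 0 < η k := fun k => by positivity
  have hηlim : Filter.Tendsto η Filter.atTop (nhds 0) := tendsto_one_div_add_atTop_nhds_zero_nat
  obtain ⟨c, hc, ψ, hψ, hlim⟩ := (isCompact_Icc (a := κ) (b := 2 * ca)).tendsto_subseq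
    (x := fun k => K (η k)) fun k => ⟨hK1 _ (hη k), hK2 _ (hη k)⟩
  have hηψ : Filter.Tendsto (η ∘ ψ) Filter.atTop (nhds 0) := hηlim.comp hψ.tendsto_atTop
  have hcpos : 0 < c := hκ.trans_le hc.1
  have hcca : c ≤ ca := by
    have h1 : Filter.Tendsto (fun k => K (η (ψ k)) - η (ψ k)) Filter.atTop (nhds (c - 0)) :=
      hlim.sub hηψ
    have h2 : Filter.Tendsto (fun k => ca * (1 + η (ψ k))) Filter.atTop (nhds (ca * (1 + 0))) :=
      (hηψ.const_add 1).const_mul ca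
    rw [sub_zero] at h1
    rw [add_zero, mul_one] at h2
    refine le_of_tendsto_of_tendsto' h1 h2 fun k => ?_
    obtain ⟨Q, hQ, hb⟩ := hK _ (hη (ψ k)) 1
    have hb' := (hb (Pi.single 0 1)).2
    have h0 := (hE.1 _ Q hQ).snd_le (Pi.single 0 1)
    rw [(hE.1 _ Q hQ).single_eq_one] at h0
    rw [Pi.norm_single, norm_one, mul_one, mul_one, abs_le] at hb'
    have hca : 0 ≤ ca := by
      have := (apply_nonneg Q.2 (Pi.single 0 1)).trans h0
      linarith
    have := mul_nonneg hca (hη (ψ k)).le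
    linarith [hb'.1]
  lift c to NNReal using hcpos.le
  refine ⟨c, NNReal.coe_pos.1 hcpos, fun n => hE.2.1 n _ (memB_supPair hcb hcca n) fun ε hε => ?_⟩
  have h3 : Filter.Tendsto (fun k => η (ψ k) + |K (η (ψ k)) - c|) Filter.atTop (nhds 0) := by
    have : Filter.Tendsto (fun k => |K (η (ψ k)) - c|) Filter.atTop (nhds 0) := by
      have := (hlim.sub_const c).abs
      simpa using this
    simpa using hηψ.add this
  obtain ⟨k, hk⟩ := (h3.eventually (gt_mem_nhds hε)).exists
  obtain ⟨Q, hQ, hb⟩ := hK _ (hη (ψ k)) n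
  refine ⟨Q, hQ, lt_of_le_of_lt ?_ hk⟩
  refine csSup_le ⟨_, 0, by simp, rfl⟩ ?_
  rintro x ⟨a, ha, rfl⟩
  have ha1 : ‖a‖ ≤ 1 := (pi_norm_le_iff_of_nonneg zero_le_one).2 ha
  rw [supPair_fst, supPair_snd]
  have hle : η (ψ k) * ‖a‖ ≤ η (ψ k) := mul_le_of_le_one_right (hη _).le ha1
  refine max_le ?_ ?_
  · rw [abs_sub_comm]
    have := (hb a).1
    have := abs_nonneg (K (η (ψ k)) - c)
    linarith
  · rw [abs_sub_comm]
    calc |Q.2 a - c * ‖a‖| = |(Q.2 a - K (η (ψ k)) * ‖a‖) + (K (η (ψ k)) - c) * ‖a‖| := by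
          congr 1; ring
      _ ≤ |Q.2 a - K (η (ψ k)) * ‖a‖| + |(K (η (ψ k)) - c) * ‖a‖| := abs_add_le _ _
      _ ≤ η (ψ k) + |K (η (ψ k)) - c| := by
          refine add_le_add ((hb a).2.trans hle) ?_
          rw [abs_mul, abs_norm]
          exact mul_le_of_le_one_right (abs_nonneg _) ha1

theorem card_sq_le_sum_fibers {m K : ℕ} (S : Finset (Fin (m + 1) → Fin K)) :
    (S.card : ℝ) ^ 2 ≤ K ^ m * ∑ u, ∑ v, (((Finset.univ : Finset (Fin m → Fin K)).filter fun y =>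
      (Fin.cons u y : Fin (m + 1) → Fin K) ∈ S ∧
        (Fin.cons v y : Fin (m + 1) → Fin K) ∈ S).card : ℝ) := by
  let g : Fin K → (Fin m → Fin K) → ℝ := fun u y =>
    if (Fin.cons u y : Fin (m + 1) → Fin K) ∈ S then 1 else 0
  have hfib : ∀ u v, (((Finset.univ : Finset (Fin m → Fin K)).filter fun y =>
      (Fin.cons u y : Fin (m + 1) → Fin K) ∈ S ∧
        (Fin.cons v y : Fin (m + 1) → Fin K) ∈ S).card : ℝ) = ∑ y, g u y * g v y := by
    intro u v
    rw [Finset.card_filter]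
    push_cast
    refine Finset.sum_congr rfl fun y _ => ?_
    by_cases h1 : (Fin.cons u y : Fin (m + 1) → Fin K) ∈ S <;>
      by_cases h2 : (Fin.cons v y : Fin (m + 1) → Fin K) ∈ S <;> simp only [g, h1, h2] <;> norm_num
  have hSg : (S.card : ℝ) = ∑ y, ∑ u, g u y := by
    have h1 : (S.card : ℝ) = ∑ x, if x ∈ S then (1 : ℝ) else 0 := by
      rw [Finset.sum_boole, Finset.filter_univ_mem]
    rw [h1, Finset.sum_comm, ← Fintype.sum_prod_type',
      ← (Fin.consEquiv fun _ : Fin (m + 1) => Fin K).sum_comp]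
    rfl
  rw [hSg]
  refine sq_sum_le_card_mul_sum_sq.trans (le_of_eq ?_)
  congr 1
  · simp
  · simp_rw [hfib, sq, Finset.sum_mul_sum]
    rw [Finset.sum_comm]
    refine Finset.sum_congr rfl fun u _ => ?_
    rw [Finset.sum_comm]

/-- Dense subsets of a power `(Fin K)^m` contain combinatorial boxes `∏ j, {u j, v j}` once `K`
is large. -/
theorem exists_box (m : ℕ) : ∀ d : ℝ, 0 < d → ∃ K₀ : ℕ, ∀ K ≥ K₀,
    ∀ S : Finset (Fin m → Fin K), d * (K : ℝ) ^ m ≤ S.card →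
      ∃ u v : Fin m → Fin K, (∀ j, u j ≠ v j) ∧
        ∀ η : Fin m → Bool, (fun j => if η j then u j else v j) ∈ S := by
  classical
  induction m with
  | zero =>
    intro d hd
    refine ⟨0, fun K _ S hS => ⟨Fin.elim0, Fin.elim0, fun j => j.elim0, fun η => ?_⟩⟩
    have : 0 < S.card := by
      rw [pow_zero, mul_one] at hS
      exact_mod_cast hd.trans_le hS
    obtain ⟨x, hx⟩ := Finset.card_pos.1 this
    rwa [Subsingleton.elim (fun j : Fin 0 => if η j then _ else _) x]
  | succ m ih =>
    intro d hd
    obtain ⟨K₀, hK₀⟩ := ih (d ^ 2 / 2) (by positivity)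
    obtain ⟨K₁, hK₁⟩ := exists_nat_gt (2 / d ^ 2)
    refine ⟨max K₀ K₁, fun K hK S hS => ?_⟩
    have hKpos : (2 / d ^ 2 : ℝ) < K :=
      hK₁.trans_le (by exact_mod_cast (le_max_right _ _).trans hK)
    rw [div_lt_iff₀ (by positivity)] at hKpos
    have hK0 : (0 : ℝ) < K := by
      by_contra hcon
      nlinarith [sq_nonneg d]
    let S' : Fin K → Fin K → Finset (Fin m → Fin K) := fun u v =>
      Finset.univ.filter fun y => (Fin.cons u y : Fin (m + 1) → Fin K) ∈ S ∧
        (Fin.cons v y : Fin (m + 1) → Fin K) ∈ S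
    have hcs : (S.card : ℝ) ^ 2 ≤ K ^ m * ∑ u, ∑ v, ((S' u v).card : ℝ) := card_sq_le_sum_fibers S
    obtain ⟨u, v, huv, hlarge⟩ : ∃ u v, u ≠ v ∧ d ^ 2 / 2 * (K : ℝ) ^ m ≤ (S' u v).card := by
      by_contra hcon
      push Not at hcon
      have h1 : ∀ u v, ((S' u v).card : ℝ) ≤
          d ^ 2 / 2 * (K : ℝ) ^ m + if u = v then (K : ℝ) ^ m else 0 := by
        intro u v
        split_ifs with huv
        · have : ((S' u v).card : ℝ) ≤ (K : ℝ) ^ m := by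
            have := (S' u v).card_le_univ
            rw [Fintype.card_fun, Fintype.card_fin, Fintype.card_fin] at this
            exact_mod_cast this
          have : 0 ≤ d ^ 2 / 2 * (K : ℝ) ^ m := by positivity
          linarith
        · rw [add_zero]; exact (hcon u v huv).le
      have h2 : ∑ u, ∑ v, ((S' u v).card : ℝ) ≤
          K * (K * (d ^ 2 / 2 * (K : ℝ) ^ m)) + K * (K : ℝ) ^ m := by
        refine (Finset.sum_le_sum fun u _ => Finset.sum_le_sum fun v _ => h1 u v).trans
          (le_of_eq ?_)
        simp [Finset.sum_add_distrib]
      have h3 : (d * (K : ℝ) ^ (m + 1)) ^ 2 ≤ (S.card : ℝ) ^ 2 := by gcongr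
      have h4 := (h3.trans hcs).trans (mul_le_mul_of_nonneg_left h2 (by positivity))
      have h5 : 0 < (K : ℝ) ^ m * (K : ℝ) ^ m * K := by positivity
      have h6 : (K : ℝ) ^ m * (K : ℝ) ^ m * K * (K * d ^ 2) ≤
          (K : ℝ) ^ m * (K : ℝ) ^ m * K * (K * d ^ 2 / 2 + 1) := by
        calc _ = (d * (K : ℝ) ^ (m + 1)) ^ 2 := by ring
          _ ≤ _ := h4
          _ = _ := by ring
      have := le_of_mul_le_mul_left h6 h5
      linarith
    obtain ⟨u', v', hne, hbox⟩ := hK₀ K ((le_max_left _ _).trans hK) _ hlarge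
    refine ⟨Fin.cons u u', Fin.cons v v', fun j => ?_, fun η => ?_⟩
    · refine Fin.cases ?_ (fun j => ?_) j
      · simpa using huv
      · simpa using hne j
    · have hb := hbox (fun j => η j.succ)
      simp only [S', Finset.mem_filter, Finset.mem_univ, true_and] at hb
      have he : (fun j => if η j then (Fin.cons u u' : Fin (m + 1) → Fin K) j
          else (Fin.cons v v' : Fin (m + 1) → Fin K) j) =
          Fin.cons (if η 0 then u else v) fun j => if η j.succ then u' j else v' j := by
        ext j
        refine Fin.cases ?_ (fun j => ?_) j <;> simp
      rw [he]
      split_ifs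
      · exact hb.1
      · exact hb.2

theorem norm_sgn (b : Bool) : ‖(sgn b : 𝕜)‖ = 1 := by
  cases b <;> simp [sgn]

/-- A seminorm bounded on sign vectors is bounded by twice as much on the unit ball of the sup
norm. -/
theorem seminorm_le_of_signs {m : ℕ} (p : Seminorm 𝕜 (Fin m → 𝕜)) {R : ℝ}
    (h : ∀ η : Fin m → Bool, p (fun j => sgn (η j)) ≤ R) (b : Fin m → 𝕜) :
    p b ≤ 2 * R * ‖b‖ := by
  let ι : (Fin m → ℝ) →ₗ[ℝ] (Fin m → 𝕜) :=
    { toFun := fun x j => (x j : 𝕜)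
      map_add' := fun x y => by ext j; simp
      map_smul' := fun c x => by ext j; simp [RCLike.real_smul_eq_coe_mul] }
  have hιapp : ∀ x j, ι x j = (x j : 𝕜) := fun _ _ => rfl
  let pr : Seminorm ℝ (Fin m → ℝ) := (p.restrictScalars ℝ).comp ι
  have hprapp : ∀ x, pr x = p (ι x) := fun _ => rfl
  have hcube : ∀ x : Fin m → ℝ, ‖x‖ ≤ 1 → pr x ≤ R := by
    intro x hx
    have hmem : x ∈ convexHull ℝ (Set.univ.pi fun _ : Fin m => ({-1, 1} : Set ℝ)) := by
      rw [convexHull_pi]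
      intro j _
      rw [convexHull_pair, segment_eq_Icc (by norm_num)]
      exact abs_le.1 ((norm_le_pi_norm x j).trans hx)
    obtain ⟨y, hy, hle⟩ := pr.convexOn.exists_ge_of_mem_convexHull (Set.subset_univ _) hmem
    refine hle.trans ((le_of_eq ?_).trans (h (fun j => decide (y j = 1))))
    rw [hprapp]
    congr 1
    ext j
    rw [hιapp]
    rcases hy j (Set.mem_univ j) with h1 | h1
    · rw [h1]; norm_num [sgn]
    · rw [Set.mem_singleton_iff] at h1
      rw [h1]; simp [sgn]
  have hreal : ∀ x : Fin m → ℝ, pr x ≤ R * ‖x‖ := by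
    intro x
    rcases eq_or_ne x 0 with rfl | hx
    · simp
    · have hpos : 0 < ‖x‖ := norm_pos_iff.2 hx
      have h1 := hcube (‖x‖⁻¹ • x) (by
        rw [norm_smul, norm_inv, norm_norm, inv_mul_cancel₀ hpos.ne'])
      rw [map_smul_eq_mul, norm_inv, norm_norm, inv_mul_eq_div, div_le_iff₀ hpos] at h1
      exact h1
  have hR : 0 ≤ R := (apply_nonneg p _).trans (h fun _ => true)
  have hsplit : b =
      ι (fun j => RCLike.re (b j)) + (RCLike.I : 𝕜) • ι (fun j => RCLike.im (b j)) := by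
    ext j
    simp only [Pi.add_apply, Pi.smul_apply, hιapp, smul_eq_mul]
    rw [mul_comm (RCLike.I : 𝕜)]
    exact (RCLike.re_add_im (b j)).symm
  have hre : ‖(fun j => RCLike.re (b j) : Fin m → ℝ)‖ ≤ ‖b‖ :=
    (pi_norm_le_iff_of_nonneg (norm_nonneg _)).2 fun j =>
      (RCLike.abs_re_le_norm (b j)).trans (norm_le_pi_norm b j)
  have him : ‖(fun j => RCLike.im (b j) : Fin m → ℝ)‖ ≤ ‖b‖ :=
    (pi_norm_le_iff_of_nonneg (norm_nonneg _)).2 fun j =>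
      (RCLike.abs_im_le_norm (b j)).trans (norm_le_pi_norm b j)
  have hI : ‖(RCLike.I : 𝕜)‖ ≤ 1 := by
    rw [RCLike.norm_I]
    split_ifs <;> norm_num
  calc p b ≤ p (ι fun j => RCLike.re (b j)) + p ((RCLike.I : 𝕜) • ι fun j => RCLike.im (b j)) := by
        conv_lhs => rw [hsplit]
        exact map_add_le_add _ _ _
    _ ≤ R * ‖b‖ + 1 * (R * ‖b‖) := by
        rw [map_smul_eq_mul]
        gcongr
        · exact (hreal _).trans (by gcongr)
        · exact (hreal _).trans (by gcongr)
    _ = 2 * R * ‖b‖ := by ring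

theorem exists_signs_box (m : ℕ) : ∃ K : ℕ, 0 < K ∧ ∀ (n : ℕ) (S : Finset (Fin n → Bool)),
    2 ^ n ≤ 2 * S.card → ∀ φ : Fin m → Fin K → Fin n,
      ∃ (w : Fin n → Bool) (u v : Fin m → Fin K), (∀ j, u j ≠ v j) ∧
        ∀ η : Fin m → Bool,
          (fun i => xor (w i) (decide (∃ j, φ j (if η j then u j else v j) = i))) ∈ S := by
  obtain ⟨K₀, hK₀⟩ := exists_box m (1 / 2) (by norm_num)
  obtain ⟨K, hK, hKK₀⟩ : ∃ K : ℕ, 0 < K ∧ K₀ ≤ K := ⟨K₀ + 1, Nat.succ_pos _, Nat.le_succ _⟩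
  refine ⟨K, hK, fun n S hS φ => ?_⟩
  let z : (Fin m → Fin K) → (Fin n → Bool) → (Fin n → Bool) := fun x w i =>
    xor (w i) (decide (∃ j, φ j (x j) = i))
  have hz : ∀ x, Function.Involutive (z x) := fun x w => by
    ext i; simp [z]
  have hcount : ∀ x, ∑ w, (if z x w ∈ S then 1 else 0) = S.card := by
    intro x
    rw [← Equiv.sum_comp (hz x).toPerm fun w => if z x w ∈ S then 1 else 0]
    simp [(hz x) _]
  have hsum : ∑ w : Fin n → Bool, (1 / 2 : ℝ) * (K : ℝ) ^ m ≤
      ∑ w, ((Finset.univ.filter fun x => z x w ∈ S).card : ℝ) := by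
    have h1 : ∑ w, (Finset.univ.filter fun x => z x w ∈ S).card = K ^ m * S.card := by
      simp_rw [Finset.card_filter]
      rw [Finset.sum_comm]
      simp_rw [hcount]
      simp
    have h2 : ∑ w, ((Finset.univ.filter fun x => z x w ∈ S).card : ℝ) = (K : ℝ) ^ m * S.card := by
      exact_mod_cast h1
    rw [h2, Finset.sum_const, Finset.card_univ, Fintype.card_fun, Fintype.card_bool,
      Fintype.card_fin, nsmul_eq_mul]
    have h3 : ((2 : ℝ)) ^ n ≤ 2 * S.card := by exact_mod_cast hS
    push_cast
    nlinarith [show (0 : ℝ) < (K : ℝ) ^ m by positivity]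
  obtain ⟨w, -, hw⟩ := Finset.exists_le_of_sum_le Finset.univ_nonempty hsum
  obtain ⟨u, v, hne, hbox⟩ := hK₀ K hKK₀ _ hw
  refine ⟨w, u, v, hne, fun η => ?_⟩
  exact (Finset.mem_filter.1 (hbox η)).2

theorem sgn_xor (b c : Bool) : (sgn (xor b c) : 𝕜) = sgn b * (1 - 2 * if c then 1 else 0) := by
  cases b <;> cases c <;> norm_num [sgn]

theorem seminorm_signs_le {n m K : ℕ} (p : Seminorm 𝕜 (Fin n → 𝕜)) {R : ℝ} (a : Fin n → 𝕜)
    (w : Fin n → Bool) (u v : Fin m → Fin K) (φ : Fin m → Fin K → Fin n)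
    (hφ : ∀ j k j' k', φ j k = φ j' k' → j = j')
    (h : ∀ η : Fin m → Bool, p (fun i =>
      sgn (xor (w i) (decide (∃ j, φ j (if η j then u j else v j) = i))) * a i) ≤ R)
    (η : Fin m → Bool) :
    p (∑ j, (sgn (η j) : 𝕜) • (Pi.single (φ j (v j)) (sgn (w (φ j (v j))) * a (φ j (v j))) -
      Pi.single (φ j (u j)) (sgn (w (φ j (u j))) * a (φ j (u j))) : Fin n → 𝕜)) ≤ R := by
  let Z : (Fin m → Bool) → Fin n → 𝕜 := fun η i =>
    sgn (xor (w i) (decide (∃ j, φ j (if η j then u j else v j) = i))) * a i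
  have hind : ∀ (η : Fin m → Bool) (i : Fin n),
      (if decide (∃ j, φ j (if η j then u j else v j) = i) then (1 : 𝕜) else 0) =
        ∑ j, if φ j (if η j then u j else v j) = i then (1 : 𝕜) else 0 := by
    intro η i
    by_cases hex : ∃ j, φ j (if η j then u j else v j) = i
    · have hex' := hex
      obtain ⟨j, hj⟩ := hex
      rw [Finset.sum_eq_single j]
      · simp [hex', hj]
      · intro j' _ hne
        exact if_neg fun hj' => hne (hφ _ _ _ _ (hj'.trans hj.symm))
      · simp
    · push Not at hex
      simp [hex]
  have hZ : ∑ j, (sgn (η j) : 𝕜) • (Pi.single (φ j (v j)) (sgn (w (φ j (v j))) * a (φ j (v j))) -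
      Pi.single (φ j (u j)) (sgn (w (φ j (u j))) * a (φ j (u j))) : Fin n → 𝕜) =
      (2⁻¹ : 𝕜) • (Z η - Z fun j => !η j) := by
    have h0 : Z η - Z (fun j => !η j) = (2 : 𝕜) • ∑ j, (sgn (η j) : 𝕜) •
        (Pi.single (φ j (v j)) (sgn (w (φ j (v j))) * a (φ j (v j))) -
          Pi.single (φ j (u j)) (sgn (w (φ j (u j))) * a (φ j (u j))) : Fin n → 𝕜) := by
      ext i
      simp only [Z, Pi.sub_apply, Pi.smul_apply, Finset.sum_apply, smul_eq_mul, sgn_xor, hind]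
      have : ∀ j, (sgn (η j) : 𝕜) *
          ((Pi.single (φ j (v j)) (sgn (w (φ j (v j))) * a (φ j (v j))) : Fin n → 𝕜) i -
          (Pi.single (φ j (u j)) (sgn (w (φ j (u j))) * a (φ j (u j))) : Fin n → 𝕜) i) =
          (sgn (w i) * a i) * ((if φ j (if !η j then u j else v j) = i then (1 : 𝕜) else 0) -
            if φ j (if η j then u j else v j) = i then (1 : 𝕜) else 0) := by
        intro j
        have hs : ∀ k, (Pi.single (φ j k) (sgn (w (φ j k)) * a (φ j k)) : Fin n → 𝕜) i =
            sgn (w i) * a i * if φ j k = i then 1 else 0 := by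
          intro k
          by_cases hk : φ j k = i
          · subst hk; simp
          · simp [hk, Ne.symm hk]
        rw [hs, hs]
        generalize (sgn (w i) : 𝕜) * a i = t
        cases η j <;> simp only [sgn, Bool.not_false, Bool.not_true, Bool.false_eq_true,
          if_true, if_false] <;> ring
      simp_rw [this]
      rw [← Finset.mul_sum, Finset.sum_sub_distrib]
      ring
    rw [h0, smul_smul, inv_mul_cancel₀ two_ne_zero, one_smul]
  rw [hZ, map_smul_eq_mul, norm_inv, RCLike.norm_ofNat]
  have h1 : p (Z η - Z fun j => !η j) ≤ p (Z η) + p (Z fun j => !η j) := map_sub_le_add _ _ _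
  have h2 : p (Z η) ≤ R := h η
  have h3 : p (Z fun j => !η j) ≤ R := h fun j => !η j
  linarith

/-- If many sign choices `ε` give `r(∑ ε_i a_i e_i) ≤ R` while `|a_i| ρ(e_i) ≥ δ R` for many
indices, then there is a `c₀`-sequence whose constant depends on `δ` only. -/
theorem exists_c0Seq_of_signs (m : ℕ) : ∃ L : ℕ, ∀ (ca cb : ℝ), 0 ≤ ca → 1 ≤ cb →
    ∀ E : Fam 𝕜, StableFam ca cb E → ∀ δ > 0, ∀ (n : ℕ), ∀ P ∈ E n, ∀ (a : Fin n → 𝕜),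
    ∀ R > 0, ∀ A : Finset (Fin n), L ≤ A.card →
    (∀ i ∈ A, δ * R ≤ ‖a i‖ * P.2 (Pi.single i 1)) →
    2 ^ n ≤ 2 * (Finset.univ.filter fun ε : Fin n → Bool =>
      P.1 (fun i => sgn (ε i) * a i) ≤ R).card →
    ∃ Q ∈ E m, IsC0Seq (δ / (4 * cb * (ca + 1))) Q := by
  obtain ⟨K, hK, hbox⟩ := exists_signs_box m
  refine ⟨m * K, fun ca cb hca hcb E hE δ hδ n P hP a R hR A hA haA hcard => ?_⟩
  have hB := hE.1 n P hP
  let emb : Fin (m * K) ↪o Fin n := (Fin.castLEOrderEmb hA).trans (A.orderEmbOfFin rfl)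
  have hembA : ∀ l, emb l ∈ A := fun l => Finset.orderEmbOfFin_mem A rfl _
  let φ : Fin m → Fin K → Fin n := fun j k => emb (finProdFinEquiv (j, k))
  have hφA : ∀ j k, φ j k ∈ A := fun j k => hembA _
  have hφinj : ∀ j k j' k', φ j k = φ j' k' → j = j' ∧ k = k' := by
    intro j k j' k' h
    simpa using finProdFinEquiv.injective (emb.injective h)
  have hφlt : ∀ j k j' k', j < j' → φ j k < φ j' k' := by
    intro j k j' k' h
    refine emb.strictMono ?_
    rw [Fin.lt_def] at h ⊢
    simp only [finProdFinEquiv_apply_val]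
    have h1 : K * ((j : ℕ) + 1) ≤ K * j' := Nat.mul_le_mul_left _ h
    have := k.2
    rw [Nat.mul_succ] at h1
    omega
  let last : Fin K := ⟨K - 1, by omega⟩
  have hφle : ∀ j k, φ j k ≤ φ j last := by
    intro j k
    refine emb.monotone ?_
    rw [Fin.le_def]
    simp only [finProdFinEquiv_apply_val]
    have := k.2
    show (k : ℕ) + K * j ≤ K - 1 + K * j
    omega
  obtain ⟨w, u, v, hne, hS⟩ := hbox n _ hcard φ
  let x : Fin m → Fin n → 𝕜 := fun j =>
    Pi.single (φ j (v j)) (sgn (w (φ j (v j))) * a (φ j (v j))) -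
      Pi.single (φ j (u j)) (sgn (w (φ j (u j))) * a (φ j (u j)))
  have hsupp : ∀ j i, x j i ≠ 0 → ∃ k, i = φ j k := by
    intro j i hi
    by_contra hcon
    push Not at hcon
    exact hi (by simp [x, hcon])
  have hsucc : Successive (fun j => φ j last) x := by
    refine ⟨fun j j' h => hφlt _ _ _ _ h, fun j i hi => ?_, fun j i hi j' hj' => ?_⟩
    · obtain ⟨k, rfl⟩ := hsupp j i hi
      exact hφle j k
    · obtain ⟨k, rfl⟩ := hsupp j i hi
      exact hφlt _ _ _ _ hj'
  have hsigns : ∀ η : Fin m → Bool, (subst P x).1 (fun j => sgn (η j)) ≤ R := by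
    intro η
    rw [subst_fst]
    exact seminorm_signs_le P.1 a w u v φ (fun j k j' k' h => (hφinj j k j' k' h).1)
      (fun η => (Finset.mem_filter.1 (hS η)).2) η
  have hupper : ∀ b : Fin m → 𝕜, P.1 (∑ j, b j • x j) ≤ 2 * R * ‖b‖ := fun b => by
    rw [← subst_fst]; exact seminorm_le_of_signs _ hsigns b
  have hxρ : ∀ j, δ * R / (2 * cb) ≤ P.2 (x j) := by
    intro j
    rw [div_le_iff₀ (by positivity)]
    have h1 := seminorm_coord_le P.2 hB.trunc_snd (x j) (φ j (v j))
    have h2 : ‖x j (φ j (v j))‖ = ‖a (φ j (v j))‖ := by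
      have : φ j (v j) ≠ φ j (u j) := fun h => hne j (hφinj _ _ _ _ h).2.symm
      simp [x, this, norm_sgn]
    rw [h2] at h1
    linarith [haA _ (hφA j (v j))]
  have hxr : ∀ j, δ * R / (2 * cb * (ca + 1)) ≤ P.1 (x j) := by
    intro j
    have h1 := (hxρ j).trans (hB.snd_le (x j))
    have h2 : P.2 (x j) ≤ (ca + 1) * P.1 (x j) := by
      nlinarith [hB.snd_le (x j), apply_nonneg P.1 (x j)]
    rw [← div_div, div_le_iff₀ (by positivity)]
    linarith [hxρ j]
  obtain ⟨Q, hQ, hQ2, hQb⟩ := exists_normalized hE hP hsucc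
    (show 0 < δ * R / (2 * cb * (ca + 1)) by positivity) hxr
  refine ⟨Q, hQ, fun j => ?_, fun b hb => ?_⟩
  · have hpos : 0 < P.1 (x j) := lt_of_lt_of_le (by positivity) (hxr j)
    have hle : P.1 (x j) ≤ 2 * R := by
      have := hupper (Pi.single j 1)
      rwa [sum_single_smul, Pi.norm_single, norm_one, mul_one] at this
    rw [hQ2, le_div_iff₀ hpos]
    calc δ / (4 * cb * (ca + 1)) * P.1 (x j) ≤ δ / (4 * cb * (ca + 1)) * (2 * R) := by gcongr
      _ = δ * R / (2 * cb) / (ca + 1) := by field_simp; norm_num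
      _ ≤ δ * R / (2 * cb) := div_le_self (by positivity) (by linarith)
      _ ≤ _ := hxρ j
  · obtain ⟨b', hb', h1, -⟩ := hQb b
    have hb1 : ‖b‖ ≤ 1 := (pi_norm_le_iff_of_nonneg zero_le_one).2 hb
    rw [h1]
    calc δ / (4 * cb * (ca + 1)) * P.1 (∑ j, b' j • x j)
        ≤ δ / (4 * cb * (ca + 1)) * (2 * R * (1 / (δ * R / (2 * cb * (ca + 1))))) := by
          gcongr
          refine (hupper b').trans ?_
          gcongr
          exact hb'.trans (by gcongr)
      _ = 1 := by field_simp; norm_num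

theorem exists_c0Class_of_c0Seq {ca cb : ℝ} {E : Fam 𝕜} (hE : StableFam ca cb E) {ϱ : ℝ}
    (hϱ : 0 < ϱ) (h : ∀ N : ℕ, ∃ n, N ≤ n ∧ ∃ P ∈ E n, IsC0Seq ϱ P) (n : ℕ) :
    (c0Class E (1 / ϱ) ϱ n).Nonempty := by
  obtain ⟨l, hl, P, hP, h1, h2⟩ := h n
  refine ⟨_, c0Class_subst hE l n (Fin.castLE hl) (Fin.castLEOrderEmb hl).strictMono P
    ⟨hP, fun a => ?_, h1⟩⟩
  rcases eq_or_ne a 0 with rfl | ha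
  · simp
  · have hpos : 0 < ‖a‖ := norm_pos_iff.2 ha
    have hn : ‖((‖a‖⁻¹ : ℝ) : 𝕜)‖ = ‖a‖⁻¹ := by
      rw [RCLike.norm_ofReal, abs_of_pos (inv_pos.2 hpos)]
    have h3 := h2 (((‖a‖⁻¹ : ℝ) : 𝕜) • a) fun i => by
      rw [Pi.smul_apply, norm_smul, hn, inv_mul_le_iff₀ hpos, mul_one]
      exact norm_le_pi_norm a i
    rw [map_smul_eq_mul, hn, inv_mul_eq_div, ← mul_div_assoc, div_le_one hpos] at h3
    rw [div_mul_eq_mul_div, one_mul, le_div_iff₀ hϱ]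
    linarith

theorem radLp_nonneg (p : ℝ≥0∞) {n : ℕ} (F : (Fin n → Bool) → ℝ) : 0 ≤ radLp p F := by
  unfold radLp
  split_ifs
  · exact Real.iSup_nonneg fun _ => abs_nonneg _
  · positivity

theorem le_radLp {p : ℝ≥0∞} (hp : p ≠ ∞) (hp0 : 0 < p.toReal) {n : ℕ} {F : (Fin n → Bool) → ℝ}
    {M : ℝ} (hM : 0 ≤ M) (h : ∀ ε, M ≤ F ε) : M ≤ radLp p F := by
  rw [radLp, if_neg hp]
  have h1 : M ^ p.toReal ≤ (∑ ε : Fin n → Bool, |F ε| ^ p.toReal) / 2 ^ n := by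
    rw [le_div_iff₀ (by positivity)]
    calc M ^ p.toReal * 2 ^ n = ∑ _ε : Fin n → Bool, M ^ p.toReal := by
          simp [mul_comm]
      _ ≤ _ := by
          refine Finset.sum_le_sum fun ε _ => ?_
          gcongr
          exact (h ε).trans (le_abs_self _)
  calc M = (M ^ p.toReal) ^ (1 / p.toReal) := by
        rw [← Real.rpow_mul hM, mul_one_div_cancel hp0.ne', Real.rpow_one]
    _ ≤ _ := by gcongr

theorem radLp_const {p : ℝ≥0∞} (hp : p ≠ ∞) {n : ℕ} :
    radLp p (fun _ : Fin n → Bool => 1) = 1 := by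
  rw [radLp, if_neg hp]
  simp

/-- Markov's inequality on the sign cube. -/
theorem card_le_of_radLp_le {p : ℝ≥0∞} (hp : p ≠ ∞) (hp1 : 1 ≤ p.toReal) {n : ℕ}
    {F : (Fin n → Bool) → ℝ} {R : ℝ} (hR : 0 < R) (h : radLp p F ≤ R) :
    2 ^ n ≤ 2 * (Finset.univ.filter fun ε => F ε ≤ 2 * R).card := by
  set q := p.toReal
  have hq0 : 0 < q := by linarith
  rw [radLp, if_neg hp, one_div, Real.rpow_inv_le_iff_of_pos (by positivity) hR.le hq0,
    div_le_iff₀ (by positivity)] at h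
  have h1 : ∑ ε : Fin n → Bool, (if ¬ F ε ≤ 2 * R then 2 * R ^ q else 0) ≤
      ∑ ε, |F ε| ^ q := by
    refine Finset.sum_le_sum fun ε _ => ?_
    split_ifs with hε
    · positivity
    · push Not at hε
      calc 2 * R ^ q ≤ 2 ^ q * R ^ q := by
            gcongr
            simpa using Real.rpow_le_rpow_of_exponent_le one_le_two hp1
        _ = (2 * R) ^ q := (Real.mul_rpow zero_le_two hR.le).symm
        _ ≤ |F ε| ^ q := by
            gcongr
            exact hε.le.trans (le_abs_self _)
  rw [← Finset.sum_filter, Finset.sum_const, nsmul_eq_mul] at h1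
  have hRq : 0 < R ^ q := by positivity
  have h2 : (((Finset.univ.filter fun ε => ¬ F ε ≤ 2 * R).card : ℝ) * 2) * R ^ q ≤
      2 ^ n * R ^ q := by linarith
  have h3 : (Finset.univ.filter fun ε => ¬ F ε ≤ 2 * R).card * 2 ≤ 2 ^ n := by
    exact_mod_cast le_of_mul_le_mul_right h2 hRq
  have h4 := Finset.card_filter_add_card_filter_not (s := (Finset.univ : Finset (Fin n → Bool)))
    (fun ε => F ε ≤ 2 * R)
  rw [Finset.card_univ, Fintype.card_fun, Fintype.card_bool, Fintype.card_fin] at h4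
  omega

theorem norm_le_signed {ca cb : ℝ} {n : ℕ} {P : SNPair 𝕜 n} (hP : MemB ca cb P)
    (a : Fin n → 𝕜) (ε : Fin n → Bool) (i : Fin n) :
    ‖a i‖ ≤ 2 * cb * P.1 (fun i => sgn (ε i) * a i) := by
  have := seminorm_coord_le P.1 hP.trunc_fst (fun i => sgn (ε i) * a i) i
  rwa [hP.single_eq_one, mul_one, norm_mul, norm_sgn, one_mul] at this

theorem norm_mul_snd {n : ℕ} (P : SNPair 𝕜 n) (a : Fin n → 𝕜) (i : Fin n) :
    ‖a i * ((P.2 (Pi.single i 1) : ℝ) : 𝕜)‖ = ‖a i‖ * P.2 (Pi.single i 1) := by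
  rw [norm_mul, RCLike.norm_ofReal, abs_of_nonneg (apply_nonneg _ _)]

theorem MemB.snd_single_le {ca cb : ℝ} {n : ℕ} {P : SNPair 𝕜 n} (hP : MemB ca cb P)
    (i : Fin n) : P.2 (Pi.single i 1) ≤ ca := by
  have := hP.snd_le (Pi.single i 1)
  rwa [hP.single_eq_one, mul_one] at this

theorem norm_le_radLp {ca cb : ℝ} (hcb : 1 ≤ cb) {n : ℕ} {P : SNPair 𝕜 n} (hP : MemB ca cb P)
    {p : ℝ≥0∞} (hp : p ≠ ∞) (hp0 : 0 < p.toReal) (a : Fin n → 𝕜) :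
    ‖a‖ ≤ 2 * cb * radLp p (fun ε => P.1 (fun i => sgn (ε i) * a i)) := by
  have h : ‖a‖ / (2 * cb) ≤ radLp p (fun ε => P.1 (fun i => sgn (ε i) * a i)) := by
    refine le_radLp hp hp0 (by positivity) fun ε => ?_
    rw [div_le_iff₀' (by positivity)]
    exact (pi_norm_le_iff_of_nonneg (by positivity)).2 (norm_le_signed hP a ε)
  rwa [div_le_iff₀' (by positivity)] at h

theorem norm_signs {n : ℕ} (hn : 1 ≤ n) (ε : Fin n → Bool) :
    ‖(fun i => sgn (ε i) : Fin n → 𝕜)‖ = 1 := by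
  refine le_antisymm ((pi_norm_le_iff_of_nonneg zero_le_one).2 fun i => norm_sgn _ |>.le) ?_
  exact (norm_sgn _).symm.trans_le
    (norm_le_pi_norm (fun i => sgn (ε i) : Fin n → 𝕜) (⟨0, hn⟩ : Fin n))

theorem le_gammaC_of_supPair {ca cb : ℝ} (hca : 0 ≤ ca) (hcb : 1 ≤ cb) {E : Fam 𝕜}
    (hE : SubB ca cb E) {q : ℝ} (hq : 1 < q) {n : ℕ} {c : ℝ} (hc : 0 < c)
    {P : SNPair 𝕜 n} (hP : P ∈ E n) (h1 : ∀ a, P.1 a = ‖a‖) (h2 : ∀ a, P.2 a = c * ‖a‖)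
    (hn : 1 ≤ n) : (n : ℝ) ^ (1 / q) * c ≤ gammaC (ENNReal.ofReal q) E n := by
  have hq0 : 0 < q := by linarith
  have hq' : (ENNReal.ofReal q).toReal = q := ENNReal.toReal_ofReal hq0.le
  refine le_csInf ⟨(n : ℝ) ^ (1 / q) * (ca + 1) * (2 * cb), by positivity, ?_⟩ ?_
  · intro Q hQ a
    have hB := hE n Q hQ
    rw [lpnorm, if_neg ENNReal.ofReal_ne_top, hq']
    simp only [norm_mul_snd]
    calc (∑ i, (‖a i‖ * Q.2 (Pi.single i 1)) ^ q) ^ (1 / q)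
        ≤ (∑ _i : Fin n, (‖a‖ * (ca + 1)) ^ q) ^ (1 / q) := by
          gcongr with i
          · exact norm_le_pi_norm a i
          · linarith [hB.snd_single_le i]
      _ = (n : ℝ) ^ (1 / q) * (‖a‖ * (ca + 1)) := by
          rw [Finset.sum_const, Finset.card_univ, Fintype.card_fin, nsmul_eq_mul,
            Real.mul_rpow (by positivity) (by positivity), ← Real.rpow_mul (by positivity),
            mul_one_div_cancel hq0.ne', Real.rpow_one]
      _ = (n : ℝ) ^ (1 / q) * (ca + 1) * ‖a‖ := by ring
      _ ≤ _ := by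
          rw [mul_assoc _ (2 * cb)]
          gcongr
          exact norm_le_radLp hcb hB ENNReal.ofReal_ne_top (by rw [hq']; exact hq0) a
  · rintro C ⟨hC, h⟩
    have := h P hP fun _ => 1
    simp only [h1, mul_one, norm_signs hn, radLp_const ENNReal.ofReal_ne_top] at this
    rw [lpnorm, if_neg ENNReal.ofReal_ne_top, hq'] at this
    simp only [h2, Pi.norm_single, norm_one, one_mul, mul_one,
      RCLike.norm_ofReal, abs_of_pos hc] at this
    rw [Finset.sum_const, Finset.card_univ, Fintype.card_fin, nsmul_eq_mul,
      Real.mul_rpow (by positivity) (by positivity), ← Real.rpow_mul (by positivity),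
      mul_one_div_cancel hq0.ne', Real.rpow_one] at this
    exact this

theorem le_bigUpsC_of_supPair {ca cb : ℝ} (hca : 0 ≤ ca) (hcb : 1 ≤ cb) {E : Fam 𝕜}
    (hE : SubB ca cb E) {n : ℕ} {c : ℝ}
    {P : SNPair 𝕜 n} (hP : P ∈ E n) (h1 : ∀ a, P.1 a = ‖a‖) (h2 : ∀ a, P.2 a = c * ‖a‖)
    (hn : 1 ≤ n) : c ≤ bigUpsC E n := by
  have : Nonempty (Fin n) := ⟨⟨0, hn⟩⟩
  refine le_csInf ⟨(ca + 1) * (2 * cb), by positivity, ?_⟩ ?_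
  · intro Q hQ a
    have hB := hE n Q hQ
    calc (⨅ i, ‖a i‖ * Q.2 (Pi.single i 1))
        ≤ ‖a ⟨0, hn⟩‖ * Q.2 (Pi.single ⟨0, hn⟩ 1) := ciInf_le (Set.finite_range _).bddBelow _
      _ ≤ ‖a‖ * (ca + 1) := by
          gcongr
          · exact norm_le_pi_norm a _
          · linarith [hB.snd_single_le ⟨0, hn⟩]
      _ = (ca + 1) * ‖a‖ := mul_comm _ _
      _ ≤ _ := by
          rw [mul_assoc]
          gcongr
          exact norm_le_radLp hcb hB ENNReal.one_ne_top (by simp) a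
  · rintro C ⟨hC, h⟩
    have := h P hP fun _ => 1
    simp only [h1, mul_one, norm_signs hn, radLp_const ENNReal.one_ne_top] at this
    simpa [h2, Pi.norm_single] using this

theorem tendsto_zero_of_eventually_le {f : ℕ → ℝ} (h0 : ∀ n, 0 ≤ f n)
    (h : ∀ δ > 0, ∃ N, ∀ n ≥ N, f n ≤ δ) : Filter.Tendsto f Filter.atTop (nhds 0) := by
  rw [Metric.tendsto_atTop]
  intro ε hε
  obtain ⟨N, hN⟩ := h (ε / 2) (by positivity)
  refine ⟨N, fun n hn => ?_⟩
  rw [Real.dist_0_eq_abs, abs_of_nonneg (h0 n)]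
  linarith [hN n hn]

theorem gammaC_nonneg (q : ℝ≥0∞) (E : Fam 𝕜) (n : ℕ) : 0 ≤ gammaC q E n :=
  Real.sInf_nonneg fun _ h => h.1.le

theorem bigUpsC_nonneg (E : Fam 𝕜) (n : ℕ) : 0 ≤ bigUpsC E n :=
  Real.sInf_nonneg fun _ h => h.1.le

theorem tendsto_bigUpsC {ca cb : ℝ} (hca : 0 ≤ ca) (hcb : 1 ≤ cb) {E : Fam 𝕜}
    (hE : StableFam ca cb E)
    (h : ∀ ϱ : ℝ, 0 < ϱ → ∃ N : ℕ, ∀ n : ℕ, N ≤ n → ∀ P ∈ E n, ¬ IsC0Seq ϱ P) :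
    Filter.Tendsto (fun n : ℕ => bigUpsC E n) Filter.atTop (nhds 0) := by
  refine tendsto_zero_of_eventually_le (bigUpsC_nonneg E) fun δ hδ => ?_
  obtain ⟨m, hm⟩ := h (δ / 2 / (4 * cb * (ca + 1))) (by positivity)
  obtain ⟨L, hL⟩ := exists_c0Seq_of_signs (𝕜 := 𝕜) m
  refine ⟨L + 1, fun n hn => csInf_le ⟨0, fun _ h => h.1.le⟩ ⟨hδ, fun P hP a => ?_⟩⟩
  by_contra hcon
  push Not at hcon
  set t := ⨅ i, ‖a i‖ * P.2 (Pi.single i 1)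
  have ht : 0 < t / δ := by
    refine div_pos (lt_of_le_of_lt ?_ hcon) hδ
    have := radLp_nonneg 1 (fun ε => P.1 (fun i => sgn (ε i) * a i))
    positivity
  have hR : radLp 1 (fun ε => P.1 (fun i => sgn (ε i) * a i)) ≤ t / δ := by
    rw [le_div_iff₀ hδ]; linarith
  obtain ⟨Q, hQ, hQc⟩ := hL ca cb hca hcb E hE (δ / 2) (by positivity) n P hP a (2 * (t / δ))
    (by positivity) Finset.univ (by rw [Finset.card_univ, Fintype.card_fin]; omega)
    (fun i _ => by
      rw [show δ / 2 * (2 * (t / δ)) = t by field_simp]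
      exact ciInf_le (Set.finite_range _).bddBelow i)
    (card_le_of_radLp_le ENNReal.one_ne_top (by simp) ht hR)
  exact hm m le_rfl Q hQ hQc

theorem tendsto_gammaC {ca cb : ℝ} (hca : 0 ≤ ca) (hcb : 1 ≤ cb) {E : Fam 𝕜}
    (hE : StableFam ca cb E)
    (h : ∀ ϱ : ℝ, 0 < ϱ → ∃ N : ℕ, ∀ n : ℕ, N ≤ n → ∀ P ∈ E n, ¬ IsC0Seq ϱ P) {q : ℝ}
    (hq : 1 < q) :
    Filter.Tendsto (fun n : ℕ => (n : ℝ) ^ (-(1 / q)) * gammaC (ENNReal.ofReal q) E n)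
      Filter.atTop (nhds 0) := by
  have hq0 : 0 < q := by linarith
  have hq' : (ENNReal.ofReal q).toReal = q := ENNReal.toReal_ofReal hq0.le
  refine tendsto_zero_of_eventually_le
    (fun n => mul_nonneg (by positivity) (gammaC_nonneg _ E n)) fun δ hδ => ?_
  obtain ⟨m, hm⟩ := h (δ / 4 / (4 * cb * (ca + 1))) (by positivity)
  obtain ⟨L, hL⟩ := exists_c0Seq_of_signs (𝕜 := 𝕜) m
  obtain ⟨H, hH0, hH⟩ : ∃ H : ℝ, 0 < H ∧ 4 * cb * ca ≤ H :=
    ⟨4 * cb * ca + 1, by positivity, by linarith⟩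
  obtain ⟨N, hN⟩ := exists_nat_ge (L / (δ ^ q / (2 * H ^ q)))
  refine ⟨N + 1, fun n hn => ?_⟩
  have hn0 : (0 : ℝ) < n := by exact_mod_cast (show 0 < n by omega)
  have hnq : (0 : ℝ) < (n : ℝ) ^ (1 / q) := by positivity
  rw [Real.rpow_neg hn0.le, inv_mul_le_iff₀ hnq]
  refine csInf_le ⟨0, fun _ h => h.1.le⟩ ⟨by positivity, fun P hP a => ?_⟩
  by_contra hcon
  push Not at hcon
  have hB := hE.1 n P hP
  rw [lpnorm, if_neg ENNReal.ofReal_ne_top, hq'] at hcon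
  simp only [norm_mul_snd] at hcon
  set c : Fin n → ℝ := fun i => ‖a i‖ * P.2 (Pi.single i 1) with hc
  have hc0 : ∀ i, 0 ≤ c i := fun i => by positivity
  set F : (Fin n → Bool) → ℝ := fun ε => P.1 (fun i => sgn (ε i) * a i) with hF
  obtain ⟨R, hRdef⟩ : ∃ R, R = (∑ i, c i ^ q) ^ (1 / q) / ((n : ℝ) ^ (1 / q) * δ) := ⟨_, rfl⟩
  have hFR : radLp (ENNReal.ofReal q) F < R := by
    rw [hRdef, lt_div_iff₀ (by positivity)]
    linarith
  have hR : 0 < R := (radLp_nonneg _ F).trans_lt hFR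
  have hsum : ∑ i, c i ^ q = n * δ ^ q * R ^ q := by
    have h1 : (∑ i, c i ^ q) ^ (1 / q) = (n : ℝ) ^ (1 / q) * δ * R := by
      rw [hRdef]; field_simp
    have h0 : 0 ≤ ∑ i, c i ^ q := Finset.sum_nonneg fun i _ => Real.rpow_nonneg (hc0 i) _
    calc ∑ i, c i ^ q = ((∑ i, c i ^ q) ^ (1 / q)) ^ q := by
          rw [← Real.rpow_mul h0, one_div_mul_cancel hq0.ne', Real.rpow_one]
      _ = ((n : ℝ) ^ (1 / q)) ^ q * δ ^ q * R ^ q := by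
          rw [h1, Real.mul_rpow (by positivity) hR.le, Real.mul_rpow hnq.le hδ.le]
      _ = n * δ ^ q * R ^ q := by
          rw [← Real.rpow_mul hn0.le, one_div_mul_cancel hq0.ne', Real.rpow_one]
  have hcard := card_le_of_radLp_le ENNReal.ofReal_ne_top (by rw [hq']; exact hq.le) hR hFR.le
  have hcH : ∀ i, c i ≤ H * R := by
    intro i
    have hpos : 0 < (Finset.univ.filter fun ε => F ε ≤ 2 * R).card := by
      have : 0 < 2 ^ n := by positivity
      omega
    obtain ⟨ε, hε⟩ := Finset.card_pos.1 hpos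
    have hε := (Finset.mem_filter.1 hε).2
    calc c i ≤ (2 * cb * F ε) * ca :=
          mul_le_mul (norm_le_signed hB a ε i) (hB.snd_single_le i) (apply_nonneg _ _)
            (mul_nonneg (by positivity) (apply_nonneg _ _))
      _ ≤ (2 * cb * (2 * R)) * ca := by gcongr
      _ = 4 * cb * ca * R := by ring
      _ ≤ H * R := by gcongr
  let A : Finset (Fin n) := Finset.univ.filter fun i => δ / 4 * (2 * R) ≤ c i
  have hA : (L : ℝ) ≤ A.card := by
    have hhalf : (δ / 2) ^ q ≤ δ ^ q / 2 := by
      rw [Real.div_rpow hδ.le zero_le_two]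
      gcongr
      simpa using Real.rpow_le_rpow_of_exponent_le one_le_two hq.le
    have h1 : ∑ i, c i ^ q ≤ ∑ i, ((if δ / 4 * (2 * R) ≤ c i then H ^ q * R ^ q else 0) +
        δ ^ q / 2 * R ^ q) := by
      refine Finset.sum_le_sum fun i _ => ?_
      split_ifs with hi
      · calc c i ^ q ≤ (H * R) ^ q := Real.rpow_le_rpow (hc0 i) (hcH i) hq0.le
          _ = H ^ q * R ^ q := Real.mul_rpow hH0.le hR.le
          _ ≤ _ := le_add_of_nonneg_right (by positivity)
      · push Not at hi
        calc c i ^ q ≤ (δ / 2 * R) ^ q :=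
              Real.rpow_le_rpow (hc0 i) (hi.le.trans_eq (by ring)) hq0.le
          _ = (δ / 2) ^ q * R ^ q := Real.mul_rpow (by positivity) hR.le
          _ ≤ 0 + δ ^ q / 2 * R ^ q := by rw [zero_add]; gcongr
    rw [Finset.sum_add_distrib, ← Finset.sum_filter, Finset.sum_const, Finset.sum_const,
      nsmul_eq_mul, nsmul_eq_mul, Finset.card_univ, Fintype.card_fin, hsum] at h1
    have hRq : 0 < R ^ q := by positivity
    have h2 : n * (δ ^ q / 2) * R ^ q ≤ A.card * H ^ q * R ^ q := by
      simp only [A]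
      linarith
    have h3 := le_of_mul_le_mul_right h2 hRq
    have h4 : (L / (δ ^ q / (2 * H ^ q)) : ℝ) ≤ n :=
      hN.trans (by exact_mod_cast (show N ≤ n by omega))
    rw [div_le_iff₀ (by positivity)] at h4
    refine h4.trans ?_
    rw [← mul_div_assoc, div_le_iff₀ (by positivity)]
    linarith
  obtain ⟨Q, hQ, hQc⟩ := hL ca cb hca hcb E hE (δ / 4) (by positivity) n P hP a (2 * R)
    (by positivity) A (by exact_mod_cast hA) (fun i hi => (Finset.mem_filter.1 hi).2) hcard
  exact hm m le_rfl Q hQ hQc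

end

/-- Theorem 3.5, block subcotype: for a stable set
`E ⊆ ⋃_{n≥1} B_n^{a,b}` the following are equivalent: block subcotype `q` for all
`1 < q < ∞`; block subcotype `q` for some `1 < q < ∞`; block subcotype (`Υ_n(E) → 0`);
for every `ϱ > 0`, the absence of `ϱ`-`c₀`-sequences in `E ∩ B_n^{a,b}` for all large `n`;
and the non-existence of `c > 0` such that `c·Id_{c₀}` is block finitely representable
on `E`. -/
theorem block_subcotype_tfae {𝕜 : Type*} [RCLike 𝕜]
    (ca cb : ℝ) (hca : 0 ≤ ca) (hcb : 1 ≤ cb)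
    (E : Fam 𝕜) (hE : StableFam ca cb E) :
    List.TFAE
      [∀ q : ℝ, 1 < q →
          Filter.Tendsto
            (fun n : ℕ => (n : ℝ) ^ (-(1 / q)) * gammaC (ENNReal.ofReal q) E n)
            Filter.atTop (nhds 0),
        ∃ q : ℝ, 1 < q ∧
          Filter.Tendsto
            (fun n : ℕ => (n : ℝ) ^ (-(1 / q)) * gammaC (ENNReal.ofReal q) E n)
            Filter.atTop (nhds 0),
        Filter.Tendsto (fun n : ℕ => bigUpsC E n) Filter.atTop (nhds 0),
        ∀ ϱ : ℝ, 0 < ϱ → ∃ N : ℕ, ∀ n : ℕ, N ≤ n → ∀ P ∈ E n, ¬ IsC0Seq ϱ P,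
        ¬ ∃ c : ℝ, 0 < c ∧ ∀ n : ℕ, 1 ≤ n → ∃ P ∈ E n,
            (∀ a : Fin n → 𝕜, P.1 a = lpnorm ∞ a) ∧
            (∀ a : Fin n → 𝕜, P.2 a = c * lpnorm ∞ a)] := by
  tfae_have 1 → 2 := fun h => ⟨2, one_lt_two, h 2 one_lt_two⟩
  tfae_have 2 → 5 := by
    rintro ⟨q, hq, h⟩ ⟨c, hc, hP⟩
    refine absurd (ge_of_tendsto h ?_) (not_le.2 hc)
    filter_upwards [Filter.eventually_ge_atTop 1] with n hn
    obtain ⟨P, hPE, h1, h2⟩ := hP n hn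
    simp only [lpnorm_top] at h1 h2
    have hn0 : (0 : ℝ) < n := by exact_mod_cast hn
    rw [Real.rpow_neg hn0.le, ← div_eq_inv_mul, le_div_iff₀' (by positivity)]
    exact le_gammaC_of_supPair hca hcb hE.1 hq hc hPE h1 h2 hn
  tfae_have 3 → 5 := by
    rintro h ⟨c, hc, hP⟩
    refine absurd (ge_of_tendsto h ?_) (not_le.2 hc)
    filter_upwards [Filter.eventually_ge_atTop 1] with n hn
    obtain ⟨P, hPE, h1, h2⟩ := hP n hn
    simp only [lpnorm_top] at h1 h2
    exact le_bigUpsC_of_supPair hca hcb hE.1 hPE h1 h2 hn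
  tfae_have 5 → 4 := by
    intro h
    by_contra hcon
    push Not at hcon
    obtain ⟨ϱ, hϱ, hseq⟩ := hcon
    obtain ⟨κ, hκ, hclass⟩ := exists_c0Class_near_one hcb hE hϱ
      (exists_c0Class_of_c0Seq hE hϱ hseq)
    obtain ⟨c, hc, hmem⟩ := exists_supPair_mem hcb hE hκ fun η hη =>
      exists_almost_isometric hca hE hκ hclass hη
    refine h ⟨c, hc, fun n _ => ⟨_, hmem n, fun a => ?_, fun a => ?_⟩⟩
    · rw [lpnorm_top, supPair_fst]
    · rw [lpnorm_top, supPair_snd]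
  tfae_have 4 → 1 := fun h q hq => tendsto_gammaC hca hcb hE h hq
  tfae_have 4 → 3 := tendsto_bigUpsC hca hcb hE
  tfae_finish

end AsymSeminorms
end
end

section
/- Let D be a directed set and n ∈ ℕ. A subset E ⊆ D^n is full if and only if there exists a pruning φ : D^{≤n} → D^{≤n} such that φ(D^n) ⊆ E. -/
namespace DirectedTrees

variable {D : Type*} [Preorder D]

/-- A subset of a preordered set is cofinal if every element is dominated by a member. -/
def Cofinal (S : Set D) : Prop := ∀ u : D, ∃ v ∈ S, u ≤ v

/-- A subset of a preordered set is eventual if its complement fails to be cofinal. -/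
def Eventual (S : Set D) : Prop := ¬ Cofinal Sᶜ

/-- `Full D n E`: the set `E ⊆ D^n` is full.  For `n = 0` this means that `E` contains the
empty sequence, and `E ⊆ D^{n+1}` is full iff the set of `u ∈ D` such that the section
`{t : (u,t) ∈ E}` is full is cofinal in `D`. -/
def Full (D : Type*) [Preorder D] : (n : ℕ) → Set (Fin n → D) → Prop
  | 0, E => (fun i : Fin 0 => i.elim0) ∈ E
  | n + 1, E => Cofinal {u : D | Full D n {t : Fin n → D | Fin.cons u t ∈ E}}

/-- `Inevitable D n E`: the set `E ⊆ D^n` is inevitable.  For `n = 0` this means that `E`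
contains the empty sequence, and `E ⊆ D^{n+1}` is inevitable iff the set of `u ∈ D` such
that the section `{t : (u,t) ∈ E}` is inevitable is eventual in `D`. -/
def Inevitable (D : Type*) [Preorder D] : (n : ℕ) → Set (Fin n → D) → Prop
  | 0, E => (fun i : Fin 0 => i.elim0) ∈ E
  | n + 1, E => Eventual {u : D | Inevitable D n {t : Fin n → D | Fin.cons u t ∈ E}}

/-- A pruning `φ : D^{≤n} → D^{≤n}`, encoded by its action on sequences of each length
`k ≤ n`: it preserves lengths, dominates the identity coordinatewise, and is compatible
with restriction to initial segments (which encodes `s < t → φ(s) < φ(t)`). -/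
structure Pruning (D : Type*) [Preorder D] (n : ℕ) where
  toFun : ∀ k : ℕ, (Fin k → D) → (Fin k → D)
  le_apply : ∀ k : ℕ, k ≤ n → ∀ t : Fin k → D, ∀ i : Fin k, t i ≤ toFun k t i
  compat : ∀ k l : ℕ, (h : k ≤ l) → l ≤ n → ∀ t : Fin l → D, ∀ i : Fin k,
    toFun k (fun j : Fin k => t (Fin.castLE h j)) i = toFun l t (Fin.castLE h i)

end DirectedTrees

namespace DirectedTrees

/-- The pruning of `D^{≤n+1}` that moves the first entry `u` to `v u` and prunes the remaining
entries by `ψ u`. -/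
def Pruning.cons {D : Type*} [Preorder D] {n : ℕ} (v : D → D) (hv : ∀ u, u ≤ v u)
    (ψ : D → Pruning D n) : Pruning D (n + 1) where
  toFun
    | 0, t => t
    | k + 1, t => Fin.cons (v (t 0)) ((ψ (t 0)).toFun k (Fin.tail t))
  le_apply := by
    rintro (_ | k) hk t i
    · exact i.elim0
    · refine Fin.cases ?_ (fun j => ?_) i
      · exact hv _
      · exact (ψ (t 0)).le_apply k (Nat.le_of_succ_le_succ hk) (Fin.tail t) j
  compat := by
    rintro (_ | k) (_ | l) h hl t i
    · exact i.elim0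
    · exact i.elim0
    · exact absurd h (Nat.not_succ_le_zero k)
    · refine Fin.cases rfl (fun j => ?_) i
      exact (ψ (t 0)).compat k l (Nat.le_of_succ_le_succ h) (Nat.le_of_succ_le_succ hl)
        (Fin.tail t) j

/-- The pruning induced on the sequences that follow a fixed first entry `u`. -/
def Pruning.tail {D : Type*} [Preorder D] {n : ℕ} (φ : Pruning D (n + 1)) (u : D) :
    Pruning D n where
  toFun k t := Fin.tail (φ.toFun (k + 1) (Fin.cons u t))
  le_apply k hk t i := φ.le_apply (k + 1) (Nat.succ_le_succ hk) (Fin.cons u t) i.succ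
  compat k l h hl t i := by
    have hcons : (Fin.cons u (fun j : Fin k => t (Fin.castLE h j)) : Fin (k + 1) → D) =
        fun j => (Fin.cons u t : Fin (l + 1) → D) (Fin.castLE (Nat.succ_le_succ h) j) := by
      funext j
      exact Fin.cases rfl (fun _ => rfl) j
    rw [hcons]
    exact φ.compat (k + 1) (l + 1) (Nat.succ_le_succ h) (Nat.succ_le_succ hl) (Fin.cons u t) i.succ

theorem Pruning.toFun_cons_eq {D : Type*} [Preorder D] {n : ℕ} (φ : Pruning D (n + 1)) (u : D)
    (t : Fin n → D) :
    φ.toFun (n + 1) (Fin.cons u t) =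
      Fin.cons (φ.toFun 1 (fun _ => u) 0) ((φ.tail u).toFun n t) := by
  have hhead : (fun _ => u : Fin 1 → D) = fun j => (Fin.cons u t : Fin (n + 1) → D)
      (Fin.castLE (Nat.succ_le_succ n.zero_le) j) := by
    funext j
    rw [Subsingleton.elim j 0]
    rfl
  rw [hhead, φ.compat 1 (n + 1) (Nat.succ_le_succ n.zero_le) le_rfl (Fin.cons u t) 0]
  exact (Fin.cons_self_tail _).symm

/-- The characterization of full sets by prunings holds over any preorder and in every length,
including length `0`. -/
theorem full_iff_exists_pruning_of_preorder {D : Type*} [Preorder D] (n : ℕ)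
    (E : Set (Fin n → D)) :
    Full D n E ↔ ∃ φ : Pruning D n, ∀ t : Fin n → D, φ.toFun n t ∈ E := by
  induction n with
  | zero =>
    refine ⟨fun hE => ⟨⟨fun _ t => t, fun _ _ _ _ => le_rfl, fun _ _ _ _ _ _ => rfl⟩,
      fun t => ?_⟩, fun ⟨φ, hφ⟩ => ?_⟩
    · rw [Subsingleton.elim t fun i : Fin 0 => i.elim0]
      exact hE
    · have h := hφ fun i => i.elim0
      rwa [Subsingleton.elim (φ.toFun 0 _) fun i : Fin 0 => i.elim0] at h
  | succ n ih =>
    constructor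
    · intro hE
      choose v hv hle using hE
      choose ψ hψ using fun u => (ih _).1 (hv u)
      exact ⟨Pruning.cons v hle ψ, fun t => hψ (t 0) (Fin.tail t)⟩
    · rintro ⟨φ, hφ⟩ u
      refine ⟨φ.toFun 1 (fun _ => u) 0, (ih _).2 ⟨φ.tail u, fun t => ?_⟩,
        φ.le_apply 1 (Nat.succ_le_succ n.zero_le) (fun _ => u) 0⟩
      rw [Set.mem_ofPred_eq, ← φ.toFun_cons_eq]
      exact hφ _

/-- Proposition 5.4(i): over a directed set `D`, a subset `E ⊆ D^n` is
full iff there is a pruning `φ : D^{≤n} → D^{≤n}` with `φ(D^n) ⊆ E`. -/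
theorem full_iff_exists_pruning {D : Type*} [Preorder D] [Nonempty D]
    [IsDirected D (· ≤ ·)] (n : ℕ) (hn : 1 ≤ n) (E : Set (Fin n → D)) :
    Full D n E ↔ ∃ φ : Pruning D n, ∀ t : Fin n → D, φ.toFun n t ∈ E :=
  full_iff_exists_pruning_of_preorder n E

end DirectedTrees
end

section
/- Let D be a directed set and n ∈ ℕ. If D^n = ⋃_{i=1}^k E_i for subsets E_1, …, E_k ⊆ D^n, then there exist 1 ≤ j ≤ k and a pruning φ : D^{≤n} → D^{≤n} such that φ(D^n) ⊆ E_j. -/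
namespace DirectedTrees

/-- If a directed set is covered by finitely many sets, one of them is cofinal. -/
theorem exists_cofinal_of_cover {D : Type*} [Preorder D] [Nonempty D]
    [IsDirected D (· ≤ ·)] {ι : Type*} [Finite ι] (S : ι → Set D)
    (hS : ∀ u, ∃ j, u ∈ S j) : ∃ j, Cofinal (S j) := by
  by_contra! h
  simp only [Cofinal, not_forall, not_exists, not_and] at h
  choose b hb using h
  obtain ⟨u, hu⟩ := Finite.exists_le b
  obtain ⟨j, hj⟩ := hS u
  exact hb j u hj (hu j)

/-- If `D^n` is covered by finitely many sets, one of them is full. -/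
theorem exists_full_of_cover {D : Type*} [Preorder D] [Nonempty D]
    [IsDirected D (· ≤ ·)] {ι : Type*} [Finite ι] (n : ℕ) (E : ι → Set (Fin n → D))
    (hE : ∀ t, ∃ j, t ∈ E j) : ∃ j, Full D n (E j) := by
  induction n with
  | zero => exact hE _
  | succ n ih =>
    refine exists_cofinal_of_cover
      (fun j => {u : D | Full D n {t : Fin n → D | Fin.cons u t ∈ E j}}) fun u => ?_
    refine ih (fun j => {t : Fin n → D | Fin.cons u t ∈ E j}) fun t => ?_
    exact hE (Fin.cons u t)

namespace Pruning

variable {D : Type*} [Preorder D] {n : ℕ}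

/-- The action on sequences of the map that sends the first entry `u` to `g u` and prunes
the remaining entries by `φ u`. -/
def consFun (g : D → D) (φ : D → Pruning D n) : (k : ℕ) → (Fin k → D) → (Fin k → D)
  | 0, t => t
  | k + 1, t => Fin.cons (α := fun _ => D) (g (t 0)) ((φ (t 0)).toFun k (Fin.tail t))

/-- The pruning that sends the first entry `u` to `g u` and prunes the remaining entries
by `φ u`. -/
def cons_s14 (g : D → D) (hg : ∀ u, u ≤ g u) (φ : D → Pruning D n) : Pruning D (n + 1) where
  toFun := consFun g φ
  le_apply k hk t i := by
    cases k with
    | zero => exact i.elim0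
    | succ k =>
      refine Fin.cases (hg _) (fun i => ?_) i
      exact (φ (t 0)).le_apply k (Nat.le_of_succ_le_succ hk) (Fin.tail t) i
  compat k l h hl t i := by
    cases k with
    | zero => exact i.elim0
    | succ k =>
      cases l with
      | zero => omega
      | succ l =>
        refine Fin.cases rfl (fun i => ?_) i
        exact (φ (t 0)).compat k l (Nat.le_of_succ_le_succ h) (Nat.le_of_succ_le_succ hl)
          (Fin.tail t) i

end Pruning

/-- A full set contains the image of a pruning. -/
theorem Full.exists_pruning {D : Type*} [Preorder D] {n : ℕ} {E : Set (Fin n → D)}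
    (hE : Full D n E) : ∃ φ : Pruning D n, ∀ t, φ.toFun n t ∈ E := by
  induction n with
  | zero =>
    refine ⟨⟨fun _ t => t, fun _ _ _ _ => le_rfl, fun _ _ _ _ _ _ => rfl⟩, fun t => ?_⟩
    rwa [Subsingleton.elim t fun i : Fin 0 => i.elim0]
  | succ n ih =>
    choose g hfull hg using hE
    choose φ hφ using fun u => ih (hfull u)
    exact ⟨Pruning.cons_s14 g hg φ, fun t => hφ (t 0) (Fin.tail t)⟩

/-- Corollary 5.5: over a directed set `D`, if `D^n` is covered by
finitely many sets `E_1, …, E_k`, then some `E_j` contains the image `φ(D^n)` of a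
pruning `φ : D^{≤n} → D^{≤n}`. -/
theorem exists_pruning_of_cover {D : Type*} [Preorder D] [Nonempty D]
    [IsDirected D (· ≤ ·)] (n : ℕ) (hn : 1 ≤ n) (k : ℕ) (hk : 1 ≤ k)
    (E : Fin k → Set (Fin n → D)) (hcover : ∀ t : Fin n → D, ∃ j : Fin k, t ∈ E j) :
    ∃ j : Fin k, ∃ φ : Pruning D n, ∀ t : Fin n → D, φ.toFun n t ∈ E j := by
  obtain ⟨j, hj⟩ := exists_full_of_cover n E hcover
  exact ⟨j, hj.exists_pruning⟩

end DirectedTrees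
end

section
/- Let X and Y be Banach spaces over 𝕂 ∈ {ℝ, ℂ} and let L(X,Y) denote the space of bounded linear operators from X to Y with the operator norm. For each n ∈ ℕ, let λ_n : L(X,Y) → [0,∞) be a seminorm which vanishes on every compact operator and satisfies λ_n(A) ≤ c_n·‖A‖ for all A ∈ L(X,Y), where c_n > 0. Define λ_∞(A) = sup_n λ_n(A), I = {A ∈ L(X,Y) : λ_∞(A) < ∞}, and λ(A) = ‖A‖ + λ_∞(A) for A ∈ I. Then I is a linear subspace of L(X,Y) containing all finite-rank operators, λ is a norm on I, and (I, λ) is a Banach space (i.e. complete). Furthermore, if sup_n c_n < ∞, then I₀ = {A ∈ L(X,Y) : lim_n λ_n(A) = 0} is a closed linear subspace of L(X,Y) in the operator-norm topology. -/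
open Filter

noncomputable section

namespace IdealSeminorms

variable {𝕜 X Y : Type*} [RCLike 𝕜]
  [NormedAddCommGroup X] [NormedSpace 𝕜 X]
  [NormedAddCommGroup Y] [NormedSpace 𝕜 Y]

/-- `λ_∞(A) < ∞`, i.e. membership in the class `I`. -/
def MemI (lam : ℕ → (X →L[𝕜] Y) → ℝ) (A : X →L[𝕜] Y) : Prop :=
  BddAbove (Set.range fun n => lam n A)

/-- The norm `λ(A) = ‖A‖ + λ_∞(A)` (with `λ_∞(A) = sup_n λ_n(A)`). -/
def lamNorm (lam : ℕ → (X →L[𝕜] Y) → ℝ) (A : X →L[𝕜] Y) : ℝ :=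
  ‖A‖ + ⨆ n, lam n A

theorem isCompactOperator_of_finiteDimensional_range (A : X →L[𝕜] Y)
    (hA : FiniteDimensional 𝕜 (LinearMap.range (A : X →ₗ[𝕜] Y))) : IsCompactOperator A := by
  have : ProperSpace (LinearMap.range (A : X →ₗ[𝕜] Y)) := FiniteDimensional.proper 𝕜 _
  exact (isCompactOperator_of_locallyCompactSpace_dom
    (A.codRestrict (LinearMap.range (A : X →ₗ[𝕜] Y)) fun x => ⟨x, rfl⟩)).clm_comp
    (Submodule.subtypeL _)

theorem continuous_of_seminorm_le {E : Type*} [SeminormedAddCommGroup E] [NormedSpace 𝕜 E]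
    (p : Seminorm 𝕜 E) {c : ℝ} (hp : ∀ x, p x ≤ c * ‖x‖) : Continuous p :=
  (LipschitzWith.of_dist_le' fun x y => by
    rw [Real.dist_eq, dist_eq_norm]
    exact (abs_sub_map_le_sub p x y).trans (hp _)).continuous

section Seminorms

variable (p : ℕ → Seminorm 𝕜 (X →L[𝕜] Y))

theorem memI_zero : MemI (fun n => p n) (0 : X →L[𝕜] Y) :=
  ⟨0, by rintro _ ⟨n, rfl⟩; exact (map_zero (p n)).le⟩

variable {p}

theorem MemI.add {A B : X →L[𝕜] Y} (hA : MemI (fun n => p n) A) (hB : MemI (fun n => p n) B) :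
    MemI (fun n => p n) (A + B) := by
  obtain ⟨a, ha⟩ := hA
  obtain ⟨b, hb⟩ := hB
  refine ⟨a + b, ?_⟩
  rintro _ ⟨n, rfl⟩
  exact (map_add_le_add (p n) A B).trans (add_le_add (ha ⟨n, rfl⟩) (hb ⟨n, rfl⟩))

theorem MemI.smul (μ : 𝕜) {A : X →L[𝕜] Y} (hA : MemI (fun n => p n) A) :
    MemI (fun n => p n) (μ • A) := by
  obtain ⟨a, ha⟩ := hA
  refine ⟨‖μ‖ * a, ?_⟩
  rintro _ ⟨n, rfl⟩
  exact (map_smul_eq_mul (p n) μ A).trans_le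
    (mul_le_mul_of_nonneg_left (ha ⟨n, rfl⟩) (norm_nonneg μ))

theorem MemI.sub {A B : X →L[𝕜] Y} (hA : MemI (fun n => p n) A) (hB : MemI (fun n => p n) B) :
    MemI (fun n => p n) (A - B) := by
  simpa [sub_eq_add_neg] using hA.add (hB.smul (-1))

theorem norm_le_lamNorm (A : X →L[𝕜] Y) : ‖A‖ ≤ lamNorm (fun n => p n) A :=
  le_add_of_nonneg_right (Real.iSup_nonneg fun n => apply_nonneg (p n) A)

theorem MemI.norm_add_le_lamNorm {A : X →L[𝕜] Y} (hA : MemI (fun n => p n) A) (n : ℕ) :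
    ‖A‖ + p n A ≤ lamNorm (fun n => p n) A :=
  add_le_add_right (le_ciSup hA n) _

theorem lamNorm_le {A : X →L[𝕜] Y} {r : ℝ} (h : ∀ n, ‖A‖ + p n A ≤ r) :
    lamNorm (fun n => p n) A ≤ r :=
  le_sub_iff_add_le'.1 (ciSup_le fun n => le_sub_iff_add_le'.2 (h n))

theorem memI_of_norm_add_le {A : X →L[𝕜] Y} {r : ℝ} (h : ∀ n, ‖A‖ + p n A ≤ r) :
    MemI (fun n => p n) A := by
  refine ⟨r, ?_⟩
  rintro _ ⟨n, rfl⟩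
  exact (le_add_of_nonneg_left (norm_nonneg A)).trans (h n)

theorem lamNorm_add_le {A B : X →L[𝕜] Y} (hA : MemI (fun n => p n) A)
    (hB : MemI (fun n => p n) B) :
    lamNorm (fun n => p n) (A + B) ≤ lamNorm (fun n => p n) A + lamNorm (fun n => p n) B :=
  lamNorm_le fun n => by
    linarith [norm_add_le A B, map_add_le_add (p n) A B, hA.norm_add_le_lamNorm n,
      hB.norm_add_le_lamNorm n]

theorem lamNorm_smul (μ : 𝕜) (A : X →L[𝕜] Y) :
    lamNorm (fun n => p n) (μ • A) = ‖μ‖ * lamNorm (fun n => p n) A := by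
  simp only [lamNorm, norm_smul, map_smul_eq_mul, mul_add,
    Real.mul_iSup_of_nonneg (norm_nonneg μ)]

theorem exists_tendsto_lamNorm_sub [CompleteSpace Y] (hp : ∀ n, Continuous (p n))
    {A : ℕ → X →L[𝕜] Y} (hA : ∀ j, MemI (fun n => p n) (A j))
    (hcau : ∀ ε : ℝ, 0 < ε → ∃ N : ℕ, ∀ j ≥ N, ∀ k ≥ N,
      lamNorm (fun n => p n) (A j - A k) < ε) :
    ∃ B : X →L[𝕜] Y, MemI (fun n => p n) B ∧
      Tendsto (fun j => lamNorm (fun n => p n) (A j - B)) atTop (nhds 0) := by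
  have hA' : CauchySeq A := by
    refine Metric.cauchySeq_iff.2 fun ε hε => ?_
    obtain ⟨N, hN⟩ := hcau ε hε
    refine ⟨N, fun j hj k hk => ?_⟩
    rw [dist_eq_norm]
    exact (norm_le_lamNorm _).trans_lt (hN j hj k hk)
  obtain ⟨B, hB⟩ := cauchySeq_tendsto_of_complete hA'
  have key : ∀ ε : ℝ, 0 < ε → ∃ N : ℕ, ∀ j ≥ N, ∀ n, ‖A j - B‖ + p n (A j - B) ≤ ε := by
    intro ε hε
    obtain ⟨N, hN⟩ := hcau ε hε
    refine ⟨N, fun j hj n => ?_⟩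
    have hlim : Tendsto (fun k => A j - A k) atTop (nhds (A j - B)) := hB.const_sub (A j)
    refine le_of_tendsto (hlim.norm.add (((hp n).tendsto _).comp hlim)) ?_
    filter_upwards [eventually_ge_atTop N] with k hk
    exact (((hA j).sub (hA k)).norm_add_le_lamNorm n).trans (hN j hj k hk).le
  refine ⟨B, ?_, ?_⟩
  · obtain ⟨N, hN⟩ := key 1 one_pos
    simpa using (hA N).sub (memI_of_norm_add_le (hN N le_rfl))
  · refine Metric.tendsto_atTop.2 fun ε hε => ?_
    obtain ⟨N, hN⟩ := key (ε / 2) (half_pos hε)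
    refine ⟨N, fun j hj => ?_⟩
    rw [Real.dist_0_eq_abs, abs_of_nonneg ((norm_nonneg (A j - B)).trans (norm_le_lamNorm _))]
    exact (lamNorm_le (hN j hj)).trans_lt (half_lt_self hε)

end Seminorms

theorem isClosed_tendsto_seminorm_zero {E : Type*} [SeminormedAddCommGroup E] [NormedSpace 𝕜 E]
    {p : ℕ → Seminorm 𝕜 E} {C : ℝ} (hp : ∀ n x, p n x ≤ C * ‖x‖) :
    IsClosed {x : E | Tendsto (fun n => p n x) atTop (nhds 0)} := by
  refine isClosed_of_closure_subset fun x hx => Metric.tendsto_atTop.2 fun ε hε => ?_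
  have hC : 0 < |C| + 1 := by positivity
  obtain ⟨y, hy, hxy⟩ := Metric.mem_closure_iff.1 hx (ε / 2 / (|C| + 1)) (by positivity)
  obtain ⟨N, hN⟩ := Metric.tendsto_atTop.1 hy (ε / 2) (half_pos hε)
  refine ⟨N, fun n hn => ?_⟩
  have h₁ := hN n hn
  rw [Real.dist_0_eq_abs, abs_of_nonneg (apply_nonneg _ _)] at h₁ ⊢
  rw [dist_eq_norm, lt_div_iff₀ hC] at hxy
  have h₂ : C * ‖x - y‖ ≤ |C| * ‖x - y‖ :=
    mul_le_mul_of_nonneg_right (le_abs_self C) (norm_nonneg _)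
  have h₃ : p n x ≤ p n (x - y) + p n y := by
    simpa using map_add_le_add (p n) (x - y) y
  linarith [hp n (x - y), norm_nonneg (x - y)]

/-- Proposition 4.2: given seminorms `λ_n` on `L(X,Y)` vanishing on
compact operators and dominated by `c_n·‖·‖`, the class `I = {A : sup_n λ_n(A) < ∞}` is a
linear subspace containing all finite-rank operators, `λ = ‖·‖ + sup_n λ_n` is a norm on
`I` making it complete; and if `sup_n c_n < ∞` then `I₀ = {A : λ_n(A) → 0}` is an
operator-norm-closed linear subspace of `L(X,Y)`. -/
theorem banach_ideal_of_seminorms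
    [CompleteSpace X] [CompleteSpace Y]
    (lam : ℕ → (X →L[𝕜] Y) → ℝ) (c : ℕ → ℝ) (hc : ∀ n, 0 < c n)
    (h_nonneg : ∀ n (A : X →L[𝕜] Y), 0 ≤ lam n A)
    (h_add : ∀ n (A B : X →L[𝕜] Y), lam n (A + B) ≤ lam n A + lam n B)
    (h_smul : ∀ n (μ : 𝕜) (A : X →L[𝕜] Y), lam n (μ • A) = ‖μ‖ * lam n A)
    (h_compact : ∀ n (A : X →L[𝕜] Y), IsCompactOperator A → lam n A = 0)
    (h_bound : ∀ n (A : X →L[𝕜] Y), lam n A ≤ c n * ‖A‖) :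
    -- `I` is a linear subspace of `L(X,Y)` …
    (MemI lam (0 : X →L[𝕜] Y)) ∧
    (∀ A B : X →L[𝕜] Y, MemI lam A → MemI lam B → MemI lam (A + B)) ∧
    (∀ (μ : 𝕜) (A : X →L[𝕜] Y), MemI lam A → MemI lam (μ • A)) ∧
    -- … containing all finite-rank operators
    (∀ A : X →L[𝕜] Y,
      FiniteDimensional 𝕜 (LinearMap.range (A : X →ₗ[𝕜] Y)) → MemI lam A) ∧
    -- `λ` is a norm on `I`
    (∀ A : X →L[𝕜] Y, MemI lam A → 0 ≤ lamNorm lam A) ∧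
    (∀ A : X →L[𝕜] Y, MemI lam A → (lamNorm lam A = 0 → A = 0)) ∧
    (∀ A B : X →L[𝕜] Y, MemI lam A → MemI lam B →
      lamNorm lam (A + B) ≤ lamNorm lam A + lamNorm lam B) ∧
    (∀ (μ : 𝕜) (A : X →L[𝕜] Y), MemI lam A →
      lamNorm lam (μ • A) = ‖μ‖ * lamNorm lam A) ∧
    -- `(I, λ)` is complete
    (∀ A : ℕ → (X →L[𝕜] Y), (∀ j, MemI lam (A j)) →
      (∀ ε : ℝ, 0 < ε → ∃ N : ℕ, ∀ j ≥ N, ∀ k ≥ N, lamNorm lam (A j - A k) < ε) →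
      ∃ B : X →L[𝕜] Y, MemI lam B ∧
        Tendsto (fun j => lamNorm lam (A j - B)) atTop (nhds 0)) ∧
    -- if `sup_n c_n < ∞`, then `I₀` is a closed linear subspace in operator norm
    ((∃ Cc : ℝ, ∀ n, c n ≤ Cc) →
      IsClosed {A : X →L[𝕜] Y | Tendsto (fun n => lam n A) atTop (nhds 0)} ∧
      Tendsto (fun n => lam n (0 : X →L[𝕜] Y)) atTop (nhds 0) ∧
      (∀ A B : X →L[𝕜] Y, Tendsto (fun n => lam n A) atTop (nhds 0) →
        Tendsto (fun n => lam n B) atTop (nhds 0) →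
        Tendsto (fun n => lam n (A + B)) atTop (nhds 0)) ∧
      (∀ (μ : 𝕜) (A : X →L[𝕜] Y), Tendsto (fun n => lam n A) atTop (nhds 0) →
        Tendsto (fun n => lam n (μ • A)) atTop (nhds 0))) := by
  obtain ⟨p, rfl⟩ : ∃ p : ℕ → Seminorm 𝕜 (X →L[𝕜] Y), lam = fun n => ⇑(p n) :=
    ⟨fun n => Seminorm.of (lam n) (h_add n) (h_smul n), rfl⟩
  refine ⟨memI_zero p, fun A B => MemI.add, fun μ A => MemI.smul μ, fun A hA => ?_,
    fun A _ => (norm_nonneg A).trans (norm_le_lamNorm A),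
    fun A _ h => norm_le_zero_iff.1 ((norm_le_lamNorm A).trans_eq h),
    fun A B => lamNorm_add_le, fun μ A _ => lamNorm_smul μ A,
    fun A => exists_tendsto_lamNorm_sub fun n => continuous_of_seminorm_le (p n) (h_bound n), ?_⟩
  · refine ⟨0, ?_⟩
    rintro _ ⟨n, rfl⟩
    exact (h_compact n A (isCompactOperator_of_finiteDimensional_range A hA)).le
  · rintro ⟨C, hC⟩
    refine ⟨isClosed_tendsto_seminorm_zero fun n A => (h_bound n A).trans
      (mul_le_mul_of_nonneg_right (hC n) (norm_nonneg A)), by simp, fun A B hA hB => ?_,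
      fun μ A hA => ?_⟩
    · exact squeeze_zero (fun n => apply_nonneg (p n) _) (fun n => map_add_le_add (p n) A B)
        (by simpa using hA.add hB)
    · simpa only [map_smul_eq_mul, mul_zero] using hA.const_mul ‖μ‖

end IdealSeminorms
end
end
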